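/- arXiv:1301.3421 — 6 statements merged into one kernel-verified Lean document; each statement's English description precedes it below -/
import Mathlib

section
/- Let M = 2K and N be even integers with K ≥ N ≥ 4, and let V be a complex inner product space of dimension M with a fixed orthonormal basis e_1, …, e_M. Then the BCS state ψ_{N,M} is not LU-equivalent to any single occupancy vector: for every unitary operator U on V, (⋀^N U) ψ_{N,M} ∉ 𝒮. -/
open ExteriorAlgebra Finset

noncomputable section

/-- The single-particle Hilbert space: `ℂ^M` with its standard inner product. -/
abbrev V (M : ℕ) : Type := EuclideanSpace ℂ (Fin M)

/-- The fixed orthonormal basis vector `e_n` (1-indexed, `1 ≤ n ≤ M`);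
out-of-range indices give `0`. -/
def stdVec (M n : ℕ) : V M :=
  if h : 1 ≤ n ∧ n ≤ M then EuclideanSpace.single (⟨n - 1, by omega⟩ : Fin M) 1 else 0

/-- The wedge `e_{i 0} ∧ ⋯ ∧ e_{i (N-1)}` in the exterior algebra of `V M`. -/
def wedge (M N : ℕ) (i : Fin N → ℕ) : ExteriorAlgebra ℂ (V M) :=
  ExteriorAlgebra.ιMulti ℂ N fun j => stdVec M (i j)

/-- `i` enumerates a strictly increasing sequence of indices in `{1, …, M}`. -/
def IsBasisIndex (M N : ℕ) (i : Fin N → ℕ) : Prop :=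
  StrictMono i ∧ ∀ j, 1 ≤ i j ∧ i j ≤ M

/-- Single occupancy: no two of the indices lie in the same standard pair
`{2k-1, 2k}` (the pair of `n` is `(n+1)/2`). -/
def SingleOcc (N : ℕ) (i : Fin N → ℕ) : Prop :=
  ∀ j k : Fin N, j ≠ k → (i j + 1) / 2 ≠ (i k + 1) / 2

/-- The single occupancy subspace `𝒮 ⊆ ⋀^N V`: the span of all basic single
occupancy vectors. -/
def SOV (M N : ℕ) : Submodule ℂ (ExteriorAlgebra ℂ (V M)) :=
  Submodule.span ℂ
    {x | ∃ i : Fin N → ℕ, IsBasisIndex M N i ∧ SingleOcc N i ∧ x = wedge M N i}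

/-- The exterior power of a unitary operator `U` on `V M`, acting on the whole
exterior algebra (on `⋀^N V` it acts as `⋀^N U`). -/
def luMap (M : ℕ) (U : V M ≃ₗᵢ[ℂ] V M) :
    ExteriorAlgebra ℂ (V M) →ₐ[ℂ] ExteriorAlgebra ℂ (V M) :=
  ExteriorAlgebra.map U.toLinearEquiv.toLinearMap

/-- The BCS state `ψ_{N,M}` for even `N` and `M = 2K`: the sum, over all
subsets `{i₁ < ⋯ < i_{N/2}} ⊆ {1, …, K}`, of
`(e_{2i₁-1} ∧ e_{2i₁}) ∧ ⋯ ∧ (e_{2i_{N/2}-1} ∧ e_{2i_{N/2}})`. -/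
def BCS (M N : ℕ) : ExteriorAlgebra ℂ (V M) :=
  ∑ s ∈ Finset.powersetCard (N / 2) (Finset.Icc 1 (M / 2)),
    ((s.sort (· ≤ ·)).map fun i =>
      ExteriorAlgebra.ι ℂ (stdVec M (2 * i - 1)) * ExteriorAlgebra.ι ℂ (stdVec M (2 * i))).prod

section Contraction

variable {E : Type*} [AddCommGroup E] [Module ℂ E]

/-- Contraction of an element of the exterior algebra by a linear form. -/
def contract (d : Module.Dual ℂ E) : ExteriorAlgebra ℂ E →ₗ[ℂ] ExteriorAlgebra ℂ E :=
  CliffordAlgebra.contractLeft (Q := (0 : QuadraticForm ℂ E)) d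

theorem contract_ι_mul (d : Module.Dual ℂ E) (v : E) (x : ExteriorAlgebra ℂ E) :
    contract d (ι ℂ v * x) = d v • x - ι ℂ v * contract d x :=
  CliffordAlgebra.contractLeft_ι_mul (Q := (0 : QuadraticForm ℂ E)) d v x

theorem contract_one (d : Module.Dual ℂ E) : contract d (1 : ExteriorAlgebra ℂ E) = 0 :=
  CliffordAlgebra.contractLeft_one (Q := (0 : QuadraticForm ℂ E)) d

theorem contract_ι (d : Module.Dual ℂ E) (v : E) :
    contract d (ι ℂ v) = d v • (1 : ExteriorAlgebra ℂ E) := by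
  simpa [contract_one] using contract_ι_mul d v 1

theorem contract_comm (d d' : Module.Dual ℂ E) (x : ExteriorAlgebra ℂ E) :
    contract d (contract d' x) = -contract d' (contract d x) :=
  CliffordAlgebra.contractLeft_comm (Q := (0 : QuadraticForm ℂ E)) d d' x

theorem contract_list_prod_eq_zero (d : Module.Dual ℂ E) (l : List E) (h : ∀ v ∈ l, d v = 0) :
    contract d (l.map (ι ℂ)).prod = 0 := by
  induction l with
  | nil => simpa using contract_one d
  | cons v l ih =>
    rw [List.map_cons, List.prod_cons, contract_ι_mul, h v (by simp),
      ih fun w hw => h w (by simp [hw])]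
    simp

theorem contract_ιMulti_eq_zero (d : Module.Dual ℂ E) {n : ℕ} (v : Fin n → E)
    (h : ∀ j, d (v j) = 0) : contract d (ιMulti ℂ n v) = 0 := by
  have := contract_list_prod_eq_zero d (List.ofFn v) (by simpa [List.mem_ofFn] using h)
  rwa [List.map_ofFn] at this

theorem ι_mul_ι_swap (v w : E) : ι ℂ v * ι ℂ w = -(ι ℂ w * ι ℂ v) :=
  eq_neg_of_add_eq_zero_left (ι_add_mul_swap v w)

theorem commute_ι_mul_ι_ι (a b v : E) : Commute (ι ℂ a * ι ℂ b) (ι ℂ v) := by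
  change _ * _ = _ * _
  rw [mul_assoc, ι_mul_ι_swap b v, mul_neg, ← mul_assoc, ι_mul_ι_swap a v, neg_mul, neg_neg,
    mul_assoc]

theorem ι_mul_ι_sq_zero (a b : E) : ι ℂ a * ι ℂ b * (ι ℂ a * ι ℂ b) = 0 := by
  rw [← mul_assoc, (commute_ι_mul_ι_ι a b a).eq, ← mul_assoc, ι_sq_zero, zero_mul, zero_mul]

/-- The two-form `∑ k ∈ S, a k ∧ b k`. -/
def pairSum (a b : ℕ → E) (S : Finset ℕ) : ExteriorAlgebra ℂ E :=
  ∑ k ∈ S, ι ℂ (a k) * ι ℂ (b k)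

/-- The map `Dual E → E` given by contraction with `∑ k ∈ S, a k ∧ b k`. -/
def pairMap (a b : ℕ → E) (S : Finset ℕ) : Module.Dual ℂ E →ₗ[ℂ] E :=
  ∑ k ∈ S, ((Module.Dual.eval ℂ E (a k)).smulRight (b k) -
    (Module.Dual.eval ℂ E (b k)).smulRight (a k))

theorem pairMap_apply (a b : ℕ → E) (S : Finset ℕ) (d : Module.Dual ℂ E) :
    pairMap a b S d = ∑ k ∈ S, (d (a k) • b k - d (b k) • a k) := by
  simp [pairMap]

variable {a b : ℕ → E} {S : Finset ℕ}

theorem commute_pairSum_ι (v : E) : Commute (pairSum a b S) (ι ℂ v) :=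
  Commute.sum_left _ _ _ fun _ _ => commute_ι_mul_ι_ι _ _ _

theorem contract_pairSum_mul (d : Module.Dual ℂ E) (x : ExteriorAlgebra ℂ E) :
    contract d (pairSum a b S * x) =
      ι ℂ (pairMap a b S d) * x + pairSum a b S * contract d x := by
  rw [pairMap_apply, pairSum, sum_mul, map_sum, map_sum, sum_mul, sum_mul, ← sum_add_distrib]
  refine sum_congr rfl fun k _ => ?_
  rw [mul_assoc, contract_ι_mul, contract_ι_mul, map_sub, map_smul, map_smul]
  simp only [mul_sub, sub_mul, smul_mul_assoc, mul_smul_comm, mul_assoc]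
  abel

theorem contract_pairSum_pow_mul (d : Module.Dual ℂ E) (n : ℕ) (x : ExteriorAlgebra ℂ E) :
    contract d (pairSum a b S ^ (n + 1) * x) =
      ((n : ℂ) + 1) • (pairSum a b S ^ n * (ι ℂ (pairMap a b S d) * x)) +
        pairSum a b S ^ (n + 1) * contract d x := by
  induction n with
  | zero => simpa using contract_pairSum_mul d x
  | succ n ih =>
    rw [pow_succ' _ (n + 1), mul_assoc, contract_pairSum_mul, ih, mul_add, mul_smul_comm,
      ← mul_assoc _ (pairSum a b S ^ n), ← pow_succ', ← mul_assoc (ι ℂ _),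
      ← ((commute_pairSum_ι (pairMap a b S d)).pow_left (n + 1)).eq, mul_assoc _ (ι ℂ _) x,
      ← mul_assoc _ _ (contract d x), ← add_assoc]
    push_cast
    module

/-- Contracting a relation `ω ^ n * x = 0` costs at most one power of the two-form `ω`. -/
theorem pairSum_pow_succ_mul_contract_eq_zero (d : Module.Dual ℂ E) (n : ℕ)
    (x : ExteriorAlgebra ℂ E) (h : pairSum a b S ^ n * x = 0) :
    pairSum a b S ^ (n + 1) * contract d x = 0 := by
  have h' : pairSum a b S ^ n * (ι ℂ (pairMap a b S d) * x) = 0 := by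
    rw [← mul_assoc, ((commute_pairSum_ι (pairMap a b S d)).pow_left n).eq, mul_assoc, h, mul_zero]
  have key := contract_pairSum_pow_mul (a := a) (b := b) (S := S) d n x
  rwa [pow_succ', mul_assoc, h, mul_zero, map_zero, h', smul_zero, zero_add, ← pow_succ',
    eq_comm] at key

theorem contract_contract_pairSum_pow_ne_zero (m : ℕ) (hm : 2 ≤ m)
    (hω : pairSum a b S ^ m ≠ 0) (hinj : Function.Injective (pairMap a b S))
    (d₁ d₂ : Module.Dual ℂ E) (h₁ : d₁ ≠ 0) (h₂ : ∀ t : ℂ, t • d₁ ≠ d₂) :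
    contract d₁ (contract d₂ (pairSum a b S ^ m)) ≠ 0 := by
  obtain ⟨p, rfl⟩ : ∃ p, m = p + 2 := ⟨m - 2, by omega⟩
  intro h
  set u := pairMap a b S d₂ with hu
  set w := pairMap a b S d₁ with hw
  have hw0 : w ≠ 0 := fun h0 => h₁ (hinj (by rw [← hw, h0, map_zero]))
  have huw : u ∉ Submodule.span ℂ {w} := by
    rw [Submodule.mem_span_singleton]
    rintro ⟨t, ht⟩
    exact h₂ t (hinj (by rw [map_smul, ← hw, ht]))
  have hne : pairSum a b S ^ (p + 1) * ι ℂ w ≠ 0 := by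
    intro h0
    obtain ⟨d, hd⟩ : ∃ d : Module.Dual ℂ E, d w ≠ 0 := by
      by_contra! hd
      exact hw0 ((Module.forall_dual_apply_eq_zero_iff ℂ w).1 hd)
    have := pairSum_pow_succ_mul_contract_eq_zero d _ _ h0
    rw [contract_ι, mul_smul_comm, mul_one] at this
    exact (smul_ne_zero hd hω) this
  have hrel : ((p : ℂ) + 1) • (pairSum a b S ^ p * (ι ℂ w * ι ℂ u)) +
      d₁ u • pairSum a b S ^ (p + 1) = 0 := by
    have e₂ := contract_pairSum_pow_mul (a := a) (b := b) (S := S) d₂ (p + 1) 1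
    rw [contract_one, mul_zero, add_zero, mul_one, mul_one] at e₂
    rw [e₂, map_smul, contract_pairSum_pow_mul, contract_ι, mul_smul_comm, mul_one] at h
    refine (smul_eq_zero.1 h).resolve_left ?_
    norm_cast
  have hp : (p : ℂ) + 1 ≠ 0 := by norm_cast
  by_cases hc : d₁ u = 0
  · rw [hc, zero_smul, add_zero] at hrel
    obtain ⟨d, hdu, hdw⟩ := Submodule.exists_dual_map_eq_bot_of_notMem huw inferInstance
    have hdw' : d w = 0 := by
      have : d w ∈ (Submodule.span ℂ {w}).map d :=
        Submodule.mem_map_of_mem (Submodule.mem_span_singleton_self w)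
      simpa [hdw] using this
    have := pairSum_pow_succ_mul_contract_eq_zero d _ _ ((smul_eq_zero.1 hrel).resolve_left hp)
    rw [contract_ι_mul, contract_ι, hdw', zero_smul, zero_sub, mul_smul_comm, mul_one, mul_neg,
      mul_smul_comm, neg_eq_zero] at this
    exact smul_ne_zero hdu hne this
  · have := congrArg (ι ℂ w * ·) hrel
    simp only [mul_add, mul_smul_comm, mul_zero] at this
    rw [← mul_assoc, ← ((commute_pairSum_ι w).pow_left p).eq, mul_assoc, ← mul_assoc (ι ℂ w),
      ι_sq_zero, zero_mul, mul_zero, smul_zero, zero_add,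
      ← ((commute_pairSum_ι w).pow_left (p + 1)).eq] at this
    exact smul_ne_zero hc hne this

/-- `α`, `β` are linear forms dual to the vectors `a k`, `b k` for `k ∈ S`. -/
structure IsDualPairs (a b : ℕ → E) (α β : ℕ → Module.Dual ℂ E) (S : Finset ℕ) : Prop where
  fst_fst : ∀ i ∈ S, ∀ j ∈ S, α i (a j) = if i = j then 1 else 0
  fst_snd : ∀ i ∈ S, ∀ j ∈ S, α i (b j) = 0
  snd_fst : ∀ i ∈ S, ∀ j ∈ S, β i (a j) = 0
  snd_snd : ∀ i ∈ S, ∀ j ∈ S, β i (b j) = if i = j then 1 else 0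

variable {α β : ℕ → Module.Dual ℂ E}

theorem IsDualPairs.snd_pairMap (h : IsDualPairs a b α β S) (d : Module.Dual ℂ E) {i : ℕ}
    (hi : i ∈ S) : β i (pairMap a b S d) = d (a i) := by
  rw [pairMap_apply, map_sum, sum_eq_single_of_mem i hi]
  · simp [h.snd_fst i hi i hi, h.snd_snd i hi i hi]
  · intro j hj hji
    simp [h.snd_fst i hi j hj, h.snd_snd i hi j hj, hji.symm]

theorem IsDualPairs.fst_pairMap (h : IsDualPairs a b α β S) (d : Module.Dual ℂ E) {i : ℕ}
    (hi : i ∈ S) : α i (pairMap a b S d) = -d (b i) := by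
  rw [pairMap_apply, map_sum, sum_eq_single_of_mem i hi]
  · simp [h.fst_fst i hi i hi, h.fst_snd i hi i hi]
  · intro j hj hji
    simp [h.fst_fst i hi j hj, h.fst_snd i hi j hj, hji.symm]

theorem IsDualPairs.pairMap_injective (h : IsDualPairs a b α β S)
    (hspan : ∀ d : Module.Dual ℂ E, (∀ k ∈ S, d (a k) = 0 ∧ d (b k) = 0) → d = 0) :
    Function.Injective (pairMap a b S) := by
  rw [injective_iff_map_eq_zero]
  intro d hd
  refine hspan d fun k hk => ⟨?_, ?_⟩
  · rw [← h.snd_pairMap d hk, hd, map_zero]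
  · rw [← neg_eq_zero, ← h.fst_pairMap d hk, hd, map_zero]

theorem IsDualPairs.pairMap_snd (h : IsDualPairs a b α β S) {i : ℕ} (hi : i ∈ S) :
    pairMap a b S (β i) = -a i := by
  rw [pairMap_apply, sum_eq_single_of_mem i hi]
  · simp [h.snd_fst i hi i hi, h.snd_snd i hi i hi]
  · intro j hj hji
    simp [h.snd_fst i hi j hj, h.snd_snd i hi j hj, hji.symm]

theorem IsDualPairs.pairSum_pow_mul_ne_zero (h : IsDualPairs a b α β S) (p : ℕ)
    (T : Finset ℕ) (hT : T ⊆ S) (hcard : T.card + p ≤ S.card) (x : ExteriorAlgebra ℂ E)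
    (hx : x ≠ 0) (hα : ∀ k ∈ S, k ∉ T → contract (α k) x = 0)
    (hβ : ∀ k ∈ S, k ∉ T → contract (β k) x = 0) :
    pairSum a b S ^ p * x ≠ 0 := by
  induction p generalizing T x with
  | zero => simpa using hx
  | succ p ih =>
    intro h0
    obtain ⟨k, hkS, hkT⟩ := exists_mem_notMem_of_card_lt_card (show T.card < S.card by omega)
    have hpow : pairSum a b S ^ p * (ι ℂ (a k) * x) = 0 := by
      have := contract_pairSum_pow_mul (a := a) (b := b) (S := S) (β k) p x
      rw [h0, map_zero, hβ k hkS hkT, mul_zero, add_zero, h.pairMap_snd hkS, map_neg, neg_mul,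
        mul_neg, smul_neg, eq_comm, neg_eq_zero] at this
      exact (smul_eq_zero.1 this).resolve_left (by norm_cast)
    refine ih (insert k T) (insert_subset hkS hT)
      (by rw [card_insert_of_notMem hkT]; omega) (ι ℂ (b k) * (ι ℂ (a k) * x)) ?_ ?_ ?_ ?_
    · intro hz
      apply hx
      have e := congrArg (fun y => contract (α k) (contract (β k) y)) hz
      simpa [contract_ι_mul, h.fst_fst k hkS k hkS, h.fst_snd k hkS k hkS,
        h.snd_fst k hkS k hkS, h.snd_snd k hkS k hkS, hα k hkS hkT, hβ k hkS hkT] using e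
    · intro j hj hjT
      rw [mem_insert, not_or] at hjT
      simp [contract_ι_mul, h.fst_fst j hj k hkS, h.fst_snd j hj k hkS, hjT.1,
        hα j hj hjT.2]
    · intro j hj hjT
      rw [mem_insert, not_or] at hjT
      simp [contract_ι_mul, h.snd_fst j hj k hkS, h.snd_snd j hj k hkS, hjT.1,
        hβ j hj hjT.2]
    · rw [← mul_assoc, ((commute_pairSum_ι (b k)).pow_left p).eq, mul_assoc, hpow, mul_zero]

theorem IsDualPairs.pairSum_pow_ne_zero (h : IsDualPairs a b α β S) (p : ℕ)
    (hp : p ≤ S.card) : pairSum a b S ^ p ≠ 0 := by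
  simpa using h.pairSum_pow_mul_ne_zero p ∅ (by simp) (by simpa using hp) 1 one_ne_zero
    (fun _ _ _ => contract_one _) (fun _ _ _ => contract_one _)

end Contraction

section PowerSum

variable {A : Type*} [Ring A]

theorem add_pow_succ_of_sq_zero {x y : A} (hxy : Commute x y) (hx : x * x = 0) (m : ℕ) :
    (x + y) ^ (m + 1) = y ^ (m + 1) + (m + 1) • (x * y ^ m) := by
  induction m with
  | zero => simp [add_comm]
  | succ m ih =>
    have hz : x * (x * y ^ m) = 0 := by rw [← mul_assoc, hx, zero_mul]
    have hy : y * (x * y ^ m) = x * y ^ (m + 1) := by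
      rw [← mul_assoc, ← hxy.eq, mul_assoc, ← pow_succ']
    rw [pow_succ', ih, mul_add, add_mul, mul_smul_comm, add_mul x y, hz, zero_add, hy,
      ← pow_succ', succ_nsmul (x * y ^ (m + 1)) (m + 1)]
    abel

/-- Powers of a sum of commuting square-zero elements are, up to a factorial, the elementary
symmetric functions of these elements. -/
theorem sum_pow_of_sq_zero (f : ℕ → A) (hcomm : ∀ i j, Commute (f i) (f j))
    (hsq : ∀ i, f i * f i = 0) (S : Finset ℕ) (m : ℕ) :
    (∑ k ∈ S, f k) ^ m =
      m.factorial • ∑ s ∈ powersetCard m S, ((s.sort (· ≤ ·)).map f).prod := by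
  induction S using Finset.induction_on_min generalizing m with
  | empty => cases m with
    | zero => simp
    | succ m => rw [powersetCard_eq_empty.2 (by simp)]; simp
  | insert a S ha ih =>
    have haS : a ∉ S := fun h => lt_irrefl _ (ha a h)
    cases m with
    | zero => simp
    | succ m =>
      rw [sum_insert haS, add_pow_succ_of_sq_zero (Commute.sum_right _ _ _ fun i _ => hcomm a i)
        (hsq a), ih, ih, powersetCard_succ_insert haS, sum_union, smul_add, sum_image]
      · congr 1
        rw [mul_smul_comm, smul_smul, ← Nat.factorial_succ, mul_sum]
        congr 1
        refine sum_congr rfl fun s hs => ?_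
        have hsS := (mem_powersetCard.1 hs).1
        rw [sort_insert _ (fun b hb => (ha b (hsS hb)).le) fun h => haS (hsS h), List.map_cons,
          List.prod_cons]
      · intro s hs t ht hst
        have hs' : a ∉ s := fun h => haS ((mem_powersetCard.1 hs).1 h)
        have ht' : a ∉ t := fun h => haS ((mem_powersetCard.1 ht).1 h)
        rw [← erase_insert hs', ← erase_insert ht', hst]
      · rw [disjoint_left]
        rintro s hs hs'
        obtain ⟨t, -, rfl⟩ := mem_image.1 hs'
        exact haS ((mem_powersetCard.1 hs).1 (mem_insert_self a t))

end PowerSum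

/-- The linear form reading off the `n`-th coordinate (1-indexed). -/
def coordForm (M n : ℕ) : Module.Dual ℂ (V M) :=
  if h : 1 ≤ n ∧ n ≤ M then
    (EuclideanSpace.proj (𝕜 := ℂ) (⟨n - 1, by omega⟩ : Fin M)).toLinearMap else 0

theorem coordForm_stdVec {M n k : ℕ} (hn : 1 ≤ n ∧ n ≤ M) (hk : 1 ≤ k ∧ k ≤ M) :
    coordForm M n (stdVec M k) = if n = k then 1 else 0 := by
  rw [coordForm, stdVec, dif_pos hn, dif_pos hk]
  have : n - 1 = k - 1 ↔ n = k := by omega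
  simp [this]

theorem dual_eq_zero_of_stdVec {M : ℕ} (d : Module.Dual ℂ (V M))
    (h : ∀ n, 1 ≤ n → n ≤ M → d (stdVec M n) = 0) : d = 0 := by
  refine (EuclideanSpace.basisFun (Fin M) ℂ).toBasis.ext fun i => ?_
  have := h (i + 1) (by omega) (by omega)
  rw [stdVec, dif_pos (by omega)] at this
  simpa using this

theorem contract_contract_eq_zero_of_mem_SOV {M N : ℕ} (hM : 2 ≤ M)
    {x : ExteriorAlgebra ℂ (V M)} (hx : x ∈ SOV M N) :
    contract (coordForm M 1) (contract (coordForm M 2) x) = 0 := by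
  induction hx using Submodule.span_induction with
  | zero => simp
  | add x y _ _ hx hy => rw [map_add, map_add, hx, hy, add_zero]
  | smul c x _ hx => rw [map_smul, map_smul, hx, smul_zero]
  | mem x hx =>
    obtain ⟨i, ⟨-, hi⟩, hocc, rfl⟩ := hx
    have hzero : ∀ n, 1 ≤ n → n ≤ M → (∀ j, i j ≠ n) →
        contract (coordForm M n) (wedge M N i) = 0 := by
      intro n h1 h2 hn
      refine contract_ιMulti_eq_zero _ _ fun j => ?_
      rw [coordForm_stdVec ⟨h1, h2⟩ (hi j), if_neg (hn j).symm]
    by_cases h2 : ∃ k, i k = 2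
    · obtain ⟨k, hk⟩ := h2
      rw [contract_comm, hzero 1 le_rfl (by omega), map_zero, neg_zero]
      intro j hj
      refine hocc j k ?_ (by rw [hj, hk])
      rintro rfl
      omega
    · push Not at h2
      rw [hzero 2 (by omega) hM h2, map_zero]

theorem factorial_smul_luMap_BCS (M N : ℕ) (U : V M ≃ₗᵢ[ℂ] V M) :
    (N / 2).factorial • luMap M U (BCS M N) =
      pairSum (fun k => U (stdVec M (2 * k - 1))) (fun k => U (stdVec M (2 * k)))
        (Icc 1 (M / 2)) ^ (N / 2) := by
  rw [pairSum, sum_pow_of_sq_zero _ (fun i j =>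
    (commute_ι_mul_ι_ι _ _ _).mul_right (commute_ι_mul_ι_ι _ _ _)) fun i => ι_mul_ι_sq_zero _ _,
    BCS, map_sum]
  congr 1
  refine sum_congr rfl fun s _ => ?_
  rw [map_list_prod, List.map_map]
  congr 2
  funext k
  simp [luMap]

theorem isDualPairs_stdVec {K M : ℕ} (hM : M = 2 * K) (U : V M ≃ₗᵢ[ℂ] V M) :
    IsDualPairs (fun k => U (stdVec M (2 * k - 1))) (fun k => U (stdVec M (2 * k)))
      (fun k => coordForm M (2 * k - 1) ∘ₗ U.symm.toLinearEquiv.toLinearMap)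
      (fun k => coordForm M (2 * k) ∘ₗ U.symm.toLinearEquiv.toLinearMap) (Icc 1 (M / 2)) := by
  constructor <;> intro i hi j hj <;> rw [mem_Icc] at hi hj <;>
    simp only [LinearMap.comp_apply, LinearEquiv.coe_coe, LinearIsometryEquiv.coe_toLinearEquiv,
      LinearIsometryEquiv.symm_apply_apply] <;>
    rw [coordForm_stdVec (by omega) (by omega)]
  · exact if_congr (by omega) rfl rfl
  · exact if_neg (by omega)
  · exact if_neg (by omega)
  · exact if_congr (by omega) rfl rfl

/-- For even `M = 2K` and even `N` with `K ≥ N ≥ 4`, the BCS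
state `ψ_{N,M}` is not LU-equivalent to any single occupancy vector. -/
theorem bcs_not_lu_equivalent_to_sov (K N : ℕ) (hN : 4 ≤ N) (hKN : N ≤ K)
    (hNeven : Even N) (M : ℕ) (hM : M = 2 * K) :
    ∀ U : V M ≃ₗᵢ[ℂ] V M, luMap M U (BCS M N) ∉ SOV M N := by
  intro U hmem
  have hdual := isDualPairs_stdVec hM U
  have hcard : (Icc 1 (M / 2)).card = K := by
    rw [Nat.card_Icc]
    omega
  have hinj := hdual.pairMap_injective fun d hd => by
    have hcomp : d ∘ₗ U.toLinearEquiv.toLinearMap = 0 := by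
      refine dual_eq_zero_of_stdVec _ fun n h1 h2 => ?_
      obtain ⟨k, rfl | rfl⟩ : ∃ k, n = 2 * k - 1 ∨ n = 2 * k := ⟨(n + 1) / 2, by omega⟩
      · exact (hd k (mem_Icc.2 (by omega))).1
      · exact (hd k (mem_Icc.2 (by omega))).2
    ext v
    simpa using LinearMap.congr_fun hcomp (U.symm v)
  have h11 : coordForm M 1 (stdVec M 1) = 1 := by
    rw [coordForm_stdVec (by omega) (by omega), if_pos rfl]
  have h12 : coordForm M 1 (stdVec M 2) = 0 := by
    rw [coordForm_stdVec (by omega) (by omega), if_neg (by omega)]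
  have h22 : coordForm M 2 (stdVec M 2) = 1 := by
    rw [coordForm_stdVec (by omega) (by omega), if_pos rfl]
  refine contract_contract_pairSum_pow_ne_zero (N / 2) (by omega)
    (hdual.pairSum_pow_ne_zero (N / 2) (by omega)) hinj (coordForm M 1) (coordForm M 2)
    (fun h => ?_) (fun t h => ?_) ?_
  · simp [h] at h11
  · rw [← h, LinearMap.smul_apply, h12, smul_zero] at h22
    exact zero_ne_one h22
  · rw [← factorial_smul_luMap_BCS, map_nsmul, map_nsmul,
      contract_contract_eq_zero_of_mem_SOV (by omega) hmem, smul_zero]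
end
end

section
/- Let V be a complex inner product space of dimension M with a fixed orthonormal basis e_1, …, e_M. For every 2-vector ψ ∈ ⋀²V there exist a unitary operator U on V, an integer k ≥ 0 with 2k ≤ M, and real numbers c_1 ≥ c_2 ≥ … ≥ c_k > 0 such that (⋀²U) ψ = Σ_{i=1}^{k} c_i · e_{2i-1} ∧ e_{2i}. -/
open ExteriorAlgebra Finset

noncomputable section

open scoped InnerProductSpace

section Skew

variable {E : Type*} [NormedAddCommGroup E] [InnerProductSpace ℂ E]

/-- A conjugate-linear map `J` is skew if `⟪x, J y⟫ = -⟪y, J x⟫` for all `x`, `y`. -/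
def IsSkewConj (J : E →ₗ⋆[ℂ] E) : Prop :=
  ∀ x y, ⟪x, J y⟫_ℂ = -⟪y, J x⟫_ℂ

theorem IsSkewConj.inner_self {J : E →ₗ⋆[ℂ] E} (hJ : IsSkewConj J) (x : E) :
    ⟪x, J x⟫_ℂ = 0 :=
  self_eq_neg.mp (hJ x x)

/-- If `‖J ·‖` is maximal at the unit vector `f` with value `c`, and `J f = c • g`, then
`J g = -c • f`. -/
theorem IsSkewConj.apply_eq_neg_smul {J : E →ₗ⋆[ℂ] E} (hJ : IsSkewConj J) {f g : E} {c : ℝ}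
    (hf : ‖f‖ = 1) (hg : ‖g‖ = 1) (hfg : J f = (c : ℂ) • g) (hle : ‖J g‖ ≤ c) :
    J g = -((c : ℂ) • f) := by
  have h1 : ⟪J g, (c : ℂ) • f⟫_ℂ = -(c : ℂ) ^ 2 := by
    rw [← inner_conj_symm, inner_smul_left, hJ, hfg, inner_smul_right,
      inner_self_eq_norm_sq_to_K, hg]
    simp
    ring
  have h2 := norm_add_sq (𝕜 := ℂ) (J g) ((c : ℂ) • f)
  have h3 : RCLike.re (-(c : ℂ) ^ 2) = -c ^ 2 := by
    norm_cast
  rw [h1, h3, norm_smul, hf, mul_one, Complex.norm_real, Real.norm_eq_abs, sq_abs] at h2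
  have h4 : ‖J g + (c : ℂ) • f‖ ^ 2 ≤ 0 := by
    nlinarith [norm_nonneg (J g)]
  have h5 : ‖J g + (c : ℂ) • f‖ = 0 := by
    nlinarith [norm_nonneg (J g + (c : ℂ) • f)]
  exact eq_neg_of_add_eq_zero_left (norm_eq_zero.mp h5)

/-- A nonzero skew conjugate-linear map on an invariant subspace has a pair of unit vectors
`f`, `g` with `J f = c • g`, `J g = -c • f`, where `c > 0` bounds `J`. -/
theorem IsSkewConj.exists_pair [FiniteDimensional ℂ E] {J : E →ₗ⋆[ℂ] E} (hJ : IsSkewConj J)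
    (S : Submodule ℂ E) (hS : ∀ x ∈ S, J x ∈ S) (hne : ∃ x ∈ S, J x ≠ 0) :
    ∃ (f g : E) (c : ℝ), f ∈ S ∧ g ∈ S ∧ ‖f‖ = 1 ∧ ‖g‖ = 1 ∧ 0 < c ∧
      J f = (c : ℂ) • g ∧ J g = -((c : ℂ) • f) ∧ ∀ x ∈ S, ‖x‖ = 1 → ‖J x‖ ≤ c := by
  have : ProperSpace E := FiniteDimensional.proper ℂ E
  obtain ⟨x, hxS, hx⟩ := hne
  have hx0 : x ≠ 0 := fun h => hx (by simp [h])
  have hxn : ‖x‖ ≠ 0 := norm_ne_zero_iff.mpr hx0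
  have hcomp : IsCompact (Metric.sphere (0 : E) 1 ∩ S) :=
    (isCompact_sphere 0 1).inter_right S.closed_of_finiteDimensional
  have hunit : ((‖x‖⁻¹ : ℝ) : ℂ) • x ∈ Metric.sphere (0 : E) 1 ∩ S := by
    refine ⟨?_, S.smul_mem _ hxS⟩
    simp [norm_smul, hxn]
  have hcont : Continuous fun y => ‖J y‖ := by
    have : FiniteDimensional ℝ E := FiniteDimensional.complexToReal E
    let J' : E →ₗ[ℝ] E :=
      { toFun := J
        map_add' := J.map_add
        map_smul' := fun r y => by
          rw [← Complex.coe_smul, J.map_smulₛₗ]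
          simp }
    exact J'.continuous_of_finiteDimensional.norm
  obtain ⟨f, ⟨hf, hfS⟩, hmax⟩ := hcomp.exists_isMaxOn ⟨_, hunit⟩ hcont.continuousOn
  have hf1 : ‖f‖ = 1 := by simpa using hf
  have hle : ∀ y ∈ S, ‖y‖ = 1 → ‖J y‖ ≤ ‖J f‖ := fun y hy hy1 =>
    hmax ⟨by simpa using hy1, hy⟩
  have hpos : 0 < ‖J f‖ := by
    refine lt_of_lt_of_le ?_ (hmax hunit)
    simp only [J.map_smulₛₗ, norm_pos_iff]
    exact smul_ne_zero (by simpa using hx0) hx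
  set c := ‖J f‖ with hc
  have hc0 : (c : ℂ) ≠ 0 := by exact_mod_cast hpos.ne'
  have hfg : J f = (c : ℂ) • ((c : ℂ)⁻¹ • J f) := (smul_inv_smul₀ hc0 _).symm
  have hgS : (c : ℂ)⁻¹ • J f ∈ S := S.smul_mem _ (hS f hfS)
  have hg1 : ‖(c : ℂ)⁻¹ • J f‖ = 1 := by
    rw [norm_smul, ← hc, norm_inv, Complex.norm_real, Real.norm_of_nonneg hpos.le]
    exact inv_mul_cancel₀ hpos.ne'
  exact ⟨f, _, c, hfS, hgS, hf1, hg1, hpos, hfg,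
    hJ.apply_eq_neg_smul hf1 hg1 hfg (hle _ hgS hg1), hle⟩

/-- Normal form of a skew conjugate-linear map on an invariant subspace. -/
theorem IsSkewConj.exists_normalForm [FiniteDimensional ℂ E] {J : E →ₗ⋆[ℂ] E}
    (hJ : IsSkewConj J) (S : Submodule ℂ E) (hS : ∀ x ∈ S, J x ∈ S) :
    ∃ (k : ℕ) (c : ℕ → ℝ) (u : ℕ → E),
      (∀ i < 2 * k, u i ∈ S) ∧
      (∀ i < 2 * k, ∀ j < 2 * k, ⟪u i, u j⟫_ℂ = if i = j then 1 else 0) ∧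
      (∀ i < k, 0 < c i) ∧
      (∀ i j, i ≤ j → j < k → c j ≤ c i) ∧
      (∀ i < k, J (u (2 * i)) = (c i : ℂ) • u (2 * i + 1)) ∧
      (∀ i < k, J (u (2 * i + 1)) = -((c i : ℂ) • u (2 * i))) ∧
      ∀ x ∈ S, (∀ i < 2 * k, ⟪u i, x⟫_ℂ = 0) → J x = 0 := by
  induction hn : Module.finrank ℂ S using Nat.strong_induction_on generalizing S with
  | _ n ih =>
  subst hn
  by_cases hne : ∃ x ∈ S, J x ≠ 0
  swap
  · push Not at hne
    exact ⟨0, 0, 0, by simp, by simp, by simp, by simp, by simp, by simp, fun x hx _ => hne x hx⟩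
  obtain ⟨f, g, c₀, hfS, hgS, hf, hg, hc₀, hJf, hJg, hle⟩ := hJ.exists_pair S hS hne
  have hc0 : (c₀ : ℂ) ≠ 0 := by exact_mod_cast hc₀.ne'
  have hff : ⟪f, f⟫_ℂ = 1 := by simp [inner_self_eq_norm_sq_to_K, hf]
  have hgg : ⟪g, g⟫_ℂ = 1 := by simp [inner_self_eq_norm_sq_to_K, hg]
  have hfg : ⟪f, g⟫_ℂ = 0 := by
    have h := hJ.inner_self f
    rw [hJf, inner_smul_right] at h
    exact (mul_eq_zero.mp h).resolve_left hc0
  have hgf : ⟪g, f⟫_ℂ = 0 := inner_eq_zero_symm.mp hfg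
  let T : Submodule ℂ E := S ⊓ ((ℂ ∙ f)ᗮ ⊓ (ℂ ∙ g)ᗮ)
  have hT : ∀ x, x ∈ T ↔ x ∈ S ∧ ⟪f, x⟫_ℂ = 0 ∧ ⟪g, x⟫_ℂ = 0 := fun x => by
    simp only [T, Submodule.mem_inf, Submodule.mem_orthogonal_singleton_iff_inner_right]
  have hTS : T < S := lt_of_le_of_ne inf_le_left fun h => by
    have := ((hT f).mp (h ▸ hfS)).2.1
    exact one_ne_zero (hff.symm.trans this)
  have hTJ : ∀ x ∈ T, J x ∈ T := fun x hx => by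
    obtain ⟨hxS, hxf, hxg⟩ := (hT x).mp hx
    refine (hT _).mpr ⟨hS x hxS, ?_, ?_⟩
    · rw [hJ, hJf, inner_smul_right, inner_eq_zero_symm.mp hxg]
      simp
    · rw [hJ, hJg, inner_neg_right, inner_smul_right, inner_eq_zero_symm.mp hxf]
      simp
  obtain ⟨k, c, u, huT, hu, hc, hanti, hJe, hJo, hker⟩ :=
    ih _ (Submodule.finrank_lt_finrank_of_lt hTS) T hTJ rfl
  have huT' := fun i hi => (hT (u i)).mp (huT i hi)
  have hcle : ∀ i < k, c i ≤ c₀ := fun i hi => by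
    have hnorm : ∀ j < 2 * k, ‖u j‖ = 1 := fun j hj => by
      have h := hu j hj j hj
      rw [if_pos rfl] at h
      rw [norm_eq_sqrt_re_inner (𝕜 := ℂ), h]
      simp
    have h := hle _ (huT' (2 * i) (by omega)).1 (hnorm _ (by omega))
    rw [hJe i hi, norm_smul, hnorm _ (by omega), mul_one, Complex.norm_real,
      Real.norm_of_nonneg (hc i hi).le] at h
    exact h
  let c' : ℕ → ℝ := fun i => Nat.casesOn i c₀ c
  let u' : ℕ → E := fun i => Nat.casesOn i f fun i => Nat.casesOn i g u
  refine ⟨k + 1, c', u', ?_, ?_, ?_, ?_, ?_, ?_, ?_⟩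
  · rintro (_ | _ | i) hi
    · exact hfS
    · exact hgS
    · exact (huT' i (by omega)).1
  · rintro (_ | _ | i) hi (_ | _ | j) hj
    · exact hff
    · simpa [u'] using hfg
    · simpa [u'] using (huT' j (by omega)).2.1
    · simpa [u'] using hgf
    · exact hgg
    · simpa [u'] using (huT' j (by omega)).2.2
    · simpa [u'] using inner_eq_zero_symm.mp (huT' i (by omega)).2.1
    · simpa [u'] using inner_eq_zero_symm.mp (huT' i (by omega)).2.2
    · simpa [u'] using hu i (by omega) j (by omega)
  · rintro (_ | i) hi
    · exact hc₀
    · exact hc i (by omega)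
  · rintro (_ | i) (_ | j) hij hj
    · exact le_rfl
    · exact hcle j (by omega)
    · omega
    · exact hanti i j (by omega) (by omega)
  · rintro (_ | i) hi
    · exact hJf
    · exact hJe i (by omega)
  · rintro (_ | i) hi
    · exact hJg
    · exact hJo i (by omega)
  · intro x hx h
    exact hker x ((hT x).mpr ⟨hx, h 0 (by omega), h 1 (by omega)⟩)
      fun i hi => h (i + 2) (by omega)

/-- Every 2-vector `ψ` is represented by a skew conjugate-linear map `J`, in the sense that
`∑ bᵢ ∧ J bᵢ = 2 ψ` for every orthonormal basis `b`. -/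
theorem exists_isSkewConj_of_mem_exteriorPower (ι : Type*) [Fintype ι]
    {ψ : ExteriorAlgebra ℂ E} (hψ : ψ ∈ ⋀[ℂ]^2 E) :
    ∃ J : E →ₗ⋆[ℂ] E, IsSkewConj J ∧ ∀ b : OrthonormalBasis ι ℂ E,
      ∑ i, ExteriorAlgebra.ι ℂ (b i) * ExteriorAlgebra.ι ℂ (J (b i)) = (2 : ℂ) • ψ := by
  rw [← ExteriorAlgebra.ιMulti_span_fixedDegree] at hψ
  induction hψ using Submodule.span_induction with
  | mem _ h =>
    obtain ⟨v, rfl⟩ := h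
    let J : E →ₗ⋆[ℂ] E :=
      { toFun := fun z => ⟪z, v 0⟫_ℂ • v 1 - ⟪z, v 1⟫_ℂ • v 0
        map_add' := fun x y => by
          simp only [inner_add_left, add_smul]
          abel
        map_smul' := fun r x => by
          simp only [inner_smul_left, mul_smul, smul_sub] }
    have hJ : ∀ z, J z = ⟪z, v 0⟫_ℂ • v 1 - ⟪z, v 1⟫_ℂ • v 0 := fun _ => rfl
    refine ⟨J, fun x y => ?_, fun b => ?_⟩
    · simp only [hJ, inner_sub_right, inner_smul_right]
      ring
    · have hsum : ∀ x y : E, ∑ i, ExteriorAlgebra.ι ℂ (b i) *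
          ExteriorAlgebra.ι ℂ (⟪b i, x⟫_ℂ • y) =
          ExteriorAlgebra.ι ℂ x * ExteriorAlgebra.ι ℂ y := fun x y => by
        conv_rhs => rw [← b.sum_repr' x, map_sum, Finset.sum_mul]
        simp
      have hswap : ExteriorAlgebra.ι ℂ (v 1) * ExteriorAlgebra.ι ℂ (v 0) =
          -(ExteriorAlgebra.ι ℂ (v 0) * ExteriorAlgebra.ι ℂ (v 1)) :=
        eq_neg_of_add_eq_zero_left (ExteriorAlgebra.ι_add_mul_swap _ _)
      simp only [hJ, map_sub, mul_sub, Finset.sum_sub_distrib, hsum, hswap, sub_neg_eq_add]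
      simp [ExteriorAlgebra.ιMulti_apply, two_smul, Matrix.vecTail]
  | zero => exact ⟨0, fun x y => by simp, fun b => by simp⟩
  | add x y _ _ hx hy =>
    obtain ⟨J, hJ, hJx⟩ := hx
    obtain ⟨K, hK, hKy⟩ := hy
    refine ⟨J + K, fun x y => ?_, fun b => ?_⟩
    · simp only [LinearMap.add_apply, inner_add_right, hJ x y, hK x y]
      ring
    · simp only [LinearMap.add_apply, map_add, mul_add, Finset.sum_add_distrib, hJx, hKy, smul_add]
  | smul r x _ hx =>
    obtain ⟨J, hJ, hJx⟩ := hx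
    refine ⟨r • J, fun x y => ?_, fun b => ?_⟩
    · simp only [LinearMap.smul_apply, inner_smul_right, hJ x y, mul_neg]
    · simp only [LinearMap.smul_apply, map_smul, mul_smul_comm, ← Finset.smul_sum, hJx]
      rw [smul_comm]

end Skew

theorem sum_range_two_mul_div_two {A : Type*} [AddCommMonoid A] (G : ℕ → A) (k : ℕ) :
    ∑ j ∈ Finset.range (2 * k), G (j / 2) = 2 • ∑ i ∈ Finset.range k, G i := by
  induction k with
  | zero => simp
  | succ k ih =>
    rw [show 2 * (k + 1) = 2 * k + 1 + 1 by ring, Finset.sum_range_succ, Finset.sum_range_succ, ih,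
      Finset.sum_range_succ, show (2 * k + 1) / 2 = k by omega, show 2 * k / 2 = k by omega,
      smul_add, two_smul ℕ (G k), add_assoc]

theorem stdVec_succ (M : ℕ) (i : Fin M) :
    stdVec M (i + 1) = EuclideanSpace.single i 1 := by
  simp [stdVec]

/-- (Existence of the canonical form for 2-vectors.) Every
`ψ ∈ ⋀² V` is LU-equivalent to `Σ_{i=1}^{k} c_i · e_{2i-1} ∧ e_{2i}` for some
`k` with `2k ≤ M` and reals `c_1 ≥ ⋯ ≥ c_k > 0`. -/
theorem two_vector_canonical_form_exists (M : ℕ)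
    (ψ : ExteriorAlgebra ℂ (V M)) (hψ : ψ ∈ ⋀[ℂ]^2 (V M)) :
    ∃ (U : V M ≃ₗᵢ[ℂ] V M) (k : ℕ) (c : ℕ → ℝ),
      2 * k ≤ M ∧
      (∀ i j : ℕ, 1 ≤ i → i ≤ j → j ≤ k → c j ≤ c i) ∧
      (∀ i : ℕ, 1 ≤ i → i ≤ k → 0 < c i) ∧
      luMap M U ψ = ∑ i ∈ Finset.Icc 1 k, (c i : ℂ) •
        (ExteriorAlgebra.ι ℂ (stdVec M (2 * i - 1)) * ExteriorAlgebra.ι ℂ (stdVec M (2 * i))) := by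
  obtain ⟨J, hJ, hJψ⟩ := exists_isSkewConj_of_mem_exteriorPower (Fin M) hψ
  obtain ⟨k, c, u, -, hu, hc, hanti, hJe, hJo, hker⟩ :=
    hJ.exists_normalForm ⊤ fun _ _ => Submodule.mem_top
  have hkM : 2 * k ≤ M := by
    have ho : Orthonormal ℂ fun i : Fin (2 * k) => u i := by
      rw [orthonormal_iff_ite]
      intro i j
      simpa [Fin.ext_iff] using hu i i.2 j j.2
    simpa using ho.linearIndependent.fintype_card_le_finrank
  obtain ⟨b, hb⟩ : ∃ b : OrthonormalBasis (Fin M) ℂ (V M), ∀ i : Fin M, i < 2 * k → b i = u i := by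
    have ho : Orthonormal ℂ ({i : Fin M | i < 2 * k}.domRestrict fun i : Fin M => u i) := by
      rw [orthonormal_iff_ite]
      rintro ⟨i, hi⟩ ⟨j, hj⟩
      simpa [Fin.ext_iff, Set.domRestrict_apply] using hu i hi j hj
    obtain ⟨b, hb⟩ := ho.exists_orthonormalBasis_extension_of_card_eq (by simp)
    exact ⟨b, fun i hi => hb i hi⟩
  have hrepr : ∀ i : Fin M, b.repr (b i) = stdVec M (i + 1) := fun i => by
    rw [b.repr_self, stdVec_succ]
  have hrepr_u : ∀ i < 2 * k, b.repr (u i) = stdVec M (i + 1) := fun i hi => by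
    rw [← hrepr ⟨i, by omega⟩, hb _ hi]
  let G : ℕ → ExteriorAlgebra ℂ (V M) := fun i => (c i : ℂ) •
    (ExteriorAlgebra.ι ℂ (stdVec M (2 * i + 1)) * ExteriorAlgebra.ι ℂ (stdVec M (2 * i + 2)))
  have hterm : ∀ i : Fin M, ExteriorAlgebra.ι ℂ (b.repr (b i)) *
      ExteriorAlgebra.ι ℂ (b.repr (J (b i))) = if (i : ℕ) < 2 * k then G (i / 2) else 0 := by
    intro i
    split_ifs with hi
    · rw [hb i hi, hrepr_u i hi]
      obtain ⟨m, hm | hm⟩ := Nat.even_or_odd' (i : ℕ)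
      · rw [hm, hJe m (by omega), map_smul, hrepr_u _ (by omega),
          show 2 * m / 2 = m by omega, map_smul, mul_smul_comm]
      · rw [hm, hJo m (by omega), map_neg, map_smul, hrepr_u _ (by omega),
          show (2 * m + 1) / 2 = m by omega, map_neg, map_smul, mul_neg, mul_smul_comm, ← smul_neg,
          ← eq_neg_of_add_eq_zero_left (ExteriorAlgebra.ι_add_mul_swap _ _)]
    · have h0 : J (b i) = 0 := hker _ Submodule.mem_top fun j hj => by
        rw [← hb ⟨j, by omega⟩ hj, b.inner_eq_ite, if_neg]
        intro h
        exact hi (h ▸ hj)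
      simp [h0]
  have hsum : (2 : ℂ) • luMap M b.repr ψ = (2 : ℂ) • ∑ i ∈ Finset.range k, G i := by
    have h2 : (2 : ℂ) • ∑ i ∈ Finset.range k, G i = 2 • ∑ i ∈ Finset.range k, G i := by
      rw [two_smul, two_smul]
    rw [h2, ← sum_range_two_mul_div_two, ← map_smul, ← hJψ b, map_sum]
    simp only [luMap, map_mul, ExteriorAlgebra.map_apply_ι]
    refine (Finset.sum_congr rfl fun i _ => hterm i).trans ?_
    rw [Fin.sum_univ_eq_sum_range (fun j => if j < 2 * k then G (j / 2) else 0), ← Finset.sum_filter]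
    congr 1
    ext j
    simp only [Finset.mem_filter, Finset.mem_range]
    omega
  refine ⟨b.repr, k, fun i => c (i - 1), hkM, fun i j hi hij hj => hanti _ _ (by omega) (by omega),
    fun i hi hik => hc _ (by omega), ?_⟩
  rw [smul_right_injective _ (two_ne_zero' ℂ) hsum]
  refine Finset.sum_bij (fun i _ => i + 1) ?_ ?_ ?_ ?_
  · intro i hi
    simp only [Finset.mem_range, Finset.mem_Icc] at hi ⊢
    omega
  · intro i _ j _ h
    omega
  · intro j hj
    simp only [Finset.mem_range, Finset.mem_Icc] at hj ⊢
    exact ⟨j - 1, by omega, by omega⟩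
  · intro i _
    simp only [G, Nat.add_sub_cancel, mul_add, mul_one]
    rfl
end
end

section
/- Let V be a complex inner product space of dimension 5 with a fixed orthonormal basis e_1, …, e_5. For every 3-vector ψ ∈ ⋀³V there exist a unitary operator U on V and real numbers c_1 ≥ c_2 ≥ 0 such that (⋀³U) ψ = (c_1 · e_1 ∧ e_2 + c_2 · e_3 ∧ e_4) ∧ e_5. -/
open ExteriorAlgebra Finset

noncomputable section

/-- For an alternating bilinear form, an orthonormal pair in `W` at which the form has maximal
modulus satisfies `B x z = 0` for all `z` in `W` orthogonal to the pair. -/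
lemma apply_eq_zero_of_isMax_orthonormalPair {E : Type*} [NormedAddCommGroup E]
    [InnerProductSpace ℂ E] (B : E →ₗ[ℂ] E →ₗ[ℂ] ℂ) (W : Submodule ℂ E) {x y : E}
    (hx : x ∈ W) (hy : y ∈ W) (hx1 : ‖x‖ = 1) (hy1 : ‖y‖ = 1) (hxy : inner ℂ x y = 0)
    (hmax : ∀ u ∈ W, ∀ v ∈ W, ‖u‖ = 1 → ‖v‖ = 1 → inner ℂ u v = 0 → ‖B u v‖ ≤ ‖B x y‖)
    {z : E} (hz : z ∈ W) (hxz : inner ℂ x z = 0) (hyz : inner ℂ y z = 0) : B x z = 0 := by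
  have h_unit : ∀ z ∈ W, ‖z‖ = 1 → inner ℂ x z = 0 → inner ℂ y z = 0 → B x z = 0 := by
    intro z hz hz1 hxz hyz
    by_contra hne
    set β := B x y
    set γ := B x z
    have hγ : 0 < ‖γ‖ := norm_pos_iff.mpr hne
    obtain ⟨s, hs, hs2⟩ : ∃ s : ℝ, 0 < s ∧ s ^ 2 = ‖β‖ ^ 2 + ‖γ‖ ^ 2 :=
      ⟨√(‖β‖ ^ 2 + ‖γ‖ ^ 2), by positivity, Real.sq_sqrt (by positivity)⟩
    set w : E := (starRingEnd ℂ β) • y + (starRingEnd ℂ γ) • z with hw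
    have hw2 : ‖w‖ ^ 2 = s ^ 2 := by
      have h := norm_add_sq_eq_norm_sq_add_norm_sq_of_inner_eq_zero (𝕜 := ℂ)
        ((starRingEnd ℂ β) • y) ((starRingEnd ℂ γ) • z)
        (by simp [inner_smul_left, inner_smul_right, hyz])
      rw [← hw] at h
      simp only [norm_smul, hy1, hz1, RCLike.norm_conj, mul_one] at h
      nlinarith
    have hwn : ‖w‖ = s := (sq_eq_sq₀ (norm_nonneg _) hs.le).mp hw2
    have hBw : B x w = ((s ^ 2 : ℝ) : ℂ) := by
      rw [hw, map_add, map_smul, map_smul, smul_eq_mul, smul_eq_mul, hs2]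
      push_cast
      rw [← Complex.conj_mul', ← Complex.conj_mul']
    have hle := hmax x hx (((s⁻¹ : ℝ) : ℂ) • w)
      (W.smul_mem _ (W.add_mem (W.smul_mem _ hy) (W.smul_mem _ hz))) hx1
      (by rw [norm_smul, hwn, Complex.norm_real, Real.norm_of_nonneg (by positivity)]
          exact inv_mul_cancel₀ hs.ne')
      (by rw [hw, inner_smul_right, inner_add_right, inner_smul_right, inner_smul_right, hxy,
            hxz]
          simp)
    rw [map_smul, norm_smul, hBw, Complex.norm_real, Complex.norm_real,
      Real.norm_of_nonneg (by positivity), Real.norm_of_nonneg (by positivity)] at hle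
    have hsle : s ≤ ‖β‖ := by
      have : s⁻¹ * s ^ 2 = s := by field_simp
      rwa [this] at hle
    nlinarith [norm_nonneg β]
  rcases eq_or_ne z 0 with rfl | hz0
  · simp
  have hn : ((‖z‖ : ℝ) : ℂ) ≠ 0 := by simpa using hz0
  have h := h_unit (((‖z‖ : ℝ) : ℂ)⁻¹ • z) (W.smul_mem _ hz)
    (by rw [norm_smul, norm_inv, Complex.norm_real, norm_norm]
        exact inv_mul_cancel₀ (norm_ne_zero_iff.mpr hz0))
    (by rw [inner_smul_right, hxz, mul_zero]) (by rw [inner_smul_right, hyz, mul_zero])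
  rw [map_smul, smul_eq_mul] at h
  exact (mul_eq_zero.mp h).resolve_left (inv_ne_zero hn)

/-- An alternating bilinear form on a subspace of dimension at least two attains its maximal
modulus over orthonormal pairs, and the maximizing pair splits off orthogonally. -/
lemma exists_isMax_orthonormalPair {E : Type*} [NormedAddCommGroup E] [InnerProductSpace ℂ E]
    [FiniteDimensional ℂ E] (B : E →ₗ[ℂ] E →ₗ[ℂ] ℂ) (hB : B.IsAlt) (W : Submodule ℂ E)
    (hW : 2 ≤ Module.finrank ℂ W) :
    ∃ x ∈ W, ∃ y ∈ W, ‖x‖ = 1 ∧ ‖y‖ = 1 ∧ inner ℂ x y = 0 ∧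
      (∀ u ∈ W, ∀ v ∈ W, ‖u‖ = 1 → ‖v‖ = 1 → inner ℂ u v = 0 → ‖B u v‖ ≤ ‖B x y‖) ∧
      ∀ z ∈ W, inner ℂ x z = 0 → inner ℂ y z = 0 → B x z = 0 ∧ B y z = 0 := by
  have : ProperSpace E := FiniteDimensional.proper ℂ E
  let S : Set (E × E) :=
    {p | p.1 ∈ W ∧ p.2 ∈ W ∧ ‖p.1‖ = 1 ∧ ‖p.2‖ = 1 ∧ inner ℂ p.1 p.2 = 0}
  have hWc : IsClosed (W : Set E) := W.closed_of_finiteDimensional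
  have hSclosed : IsClosed S :=
    (hWc.preimage continuous_fst).inter <| (hWc.preimage continuous_snd).inter <|
      (isClosed_eq (by fun_prop) (by fun_prop)).inter <|
      (isClosed_eq (by fun_prop) (by fun_prop)).inter <|
      isClosed_eq (by fun_prop) (by fun_prop)
  have hScompact : IsCompact S := by
    refine Metric.isCompact_of_isClosed_isBounded hSclosed
      (Bornology.IsBounded.subset (t := Metric.closedBall (0 : E × E) 1) Metric.isBounded_closedBall ?_)
    rintro ⟨u, v⟩ ⟨-, -, hu, hv, -⟩
    simp only at hu hv
    simp [Prod.norm_def, hu, hv]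
  have hSne : S.Nonempty := by
    let b := stdOrthonormalBasis ℂ W
    have hb := b.orthonormal
    refine ⟨(b ⟨0, by omega⟩, b ⟨1, by omega⟩), Subtype.prop _, Subtype.prop _, ?_, ?_, ?_⟩
    · exact hb.1 _
    · exact hb.1 _
    · exact hb.2 (by simp)
  have hcont : Continuous fun p : E × E => ‖B p.1 p.2‖ :=
    (B.toContinuousBilinearMap.continuous₂).norm
  obtain ⟨⟨x, y⟩, ⟨hx, hy, hx1, hy1, hxy⟩, hmax⟩ :=
    hScompact.exists_isMaxOn hSne hcont.continuousOn
  have hmax' : ∀ u ∈ W, ∀ v ∈ W, ‖u‖ = 1 → ‖v‖ = 1 → inner ℂ u v = 0 → ‖B u v‖ ≤ ‖B x y‖ :=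
    fun u hu v hv hu1 hv1 huv => hmax (show (u, v) ∈ S from ⟨hu, hv, hu1, hv1, huv⟩)
  refine ⟨x, hx, y, hy, hx1, hy1, hxy, hmax', fun z hz hxz hyz => ⟨?_, ?_⟩⟩
  · exact apply_eq_zero_of_isMax_orthonormalPair B W hx hy hx1 hy1 hxy hmax' hz hxz hyz
  · refine apply_eq_zero_of_isMax_orthonormalPair B W hy hx hy1 hx1
      (inner_eq_zero_symm.mp hxy) (fun u hu v hv hu1 hv1 huv => ?_) hz hyz hxz
    rw [← hB.neg x y, norm_neg]
    exact hmax' u hu v hv hu1 hv1 huv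

/-- An alternating bilinear form on `V 5` has an orthonormal basis in which only the pairs
`(b 0, b 1)` and `(b 2, b 3)` contribute, the latter dominating. -/
lemma exists_orthonormalBasis_isAlt (B : V 5 →ₗ[ℂ] V 5 →ₗ[ℂ] ℂ) (hB : B.IsAlt) :
    ∃ b : OrthonormalBasis (Fin 5) ℂ (V 5), ‖B (b 0) (b 1)‖ ≤ ‖B (b 2) (b 3)‖ ∧
      B (b 0) (b 2) = 0 ∧ B (b 0) (b 3) = 0 ∧ B (b 0) (b 4) = 0 ∧ B (b 1) (b 2) = 0 ∧
      B (b 1) (b 3) = 0 ∧ B (b 1) (b 4) = 0 ∧ B (b 2) (b 4) = 0 ∧ B (b 3) (b 4) = 0 := by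
  obtain ⟨x, -, y, -, hx1, hy1, hxy, hmax, hzero⟩ :=
    exists_isMax_orthonormalPair B hB ⊤ (by simp)
  have hfin : 2 ≤ Module.finrank ℂ (Submodule.span ℂ (Set.range ![x, y]))ᗮ := by
    have h1 := (Submodule.span ℂ (Set.range ![x, y])).finrank_add_finrank_orthogonal
    have h2 := finrank_range_le_card (R := ℂ) ![x, y]
    rw [Set.finrank] at h2
    simp only [finrank_euclideanSpace, Fintype.card_fin] at h1 h2
    omega
  have hperp : ∀ u ∈ (Submodule.span ℂ (Set.range ![x, y]))ᗮ,
      inner ℂ x u = 0 ∧ inner ℂ y u = 0 := fun u hu =>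
    ⟨Submodule.inner_right_of_mem_orthogonal
        (Submodule.subset_span (Set.mem_range_self (f := ![x, y]) 0)) hu,
      Submodule.inner_right_of_mem_orthogonal
        (Submodule.subset_span (Set.mem_range_self (f := ![x, y]) 1)) hu⟩
  obtain ⟨p, hp, q, hq, hp1, hq1, hpq, -, hzero'⟩ := exists_isMax_orthonormalPair B hB _ hfin
  obtain ⟨hxp, hyp⟩ := hperp p hp
  obtain ⟨hxq, hyq⟩ := hperp q hq
  obtain ⟨b, hb⟩ := Orthonormal.exists_orthonormalBasis_extension_of_card_eq (𝕜 := ℂ)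
    (E := V 5) (ι := Fin 5) (by simp) (v := ![p, q, x, y, 0]) (s := {i | i ≠ 4}) (by
      rw [orthonormal_iff_ite]
      rintro ⟨i, hi⟩ ⟨j, hj⟩
      fin_cases i <;> fin_cases j <;>
        first | exact absurd rfl hi | exact absurd rfl hj | skip
      all_goals simp_all [inner_self_eq_norm_sq_to_K, inner_eq_zero_symm])
  have h0 : b 0 = p := hb 0 (by simp)
  have h1 : b 1 = q := hb 1 (by simp)
  have h2 : b 2 = x := hb 2 (by simp)
  have h3 : b 3 = y := hb 3 (by simp)
  have hb4 : ∀ i, i ≠ 4 → inner ℂ (b i) (b 4) = 0 := fun i hi => b.orthonormal.2 hi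
  have h04 := hb4 0 (by simp)
  have h14 := hb4 1 (by simp)
  have h24 := hb4 2 (by simp)
  have h34 := hb4 3 (by simp)
  rw [h0] at h04
  rw [h1] at h14
  rw [h2] at h24
  rw [h3] at h34
  have h4mem : b 4 ∈ (Submodule.span ℂ (Set.range ![x, y]))ᗮ := by
    rw [Submodule.mem_orthogonal]
    intro u hu
    induction hu using Submodule.span_induction with
    | mem u hu =>
      obtain ⟨i, rfl⟩ := hu
      fin_cases i
      · exact h24
      · exact h34
    | zero => simp
    | add u v _ _ hu hv => rw [inner_add_left, hu, hv, add_zero]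
    | smul c u _ hu => rw [inner_smul_left, hu, mul_zero]
  have hxz := hzero (b 4) trivial h24 h34
  have hpz := hzero' (b 4) h4mem h04 h14
  have hp' := hzero p trivial hxp hyp
  have hq' := hzero q trivial hxq hyq
  refine ⟨b, ?_⟩
  rw [h0, h1, h2, h3]
  refine ⟨hmax p trivial q trivial hp1 hq1 hpq, ?_, ?_, hpz.1, ?_, ?_, hpz.2, hxz.1, hxz.2⟩
  · exact hB.isRefl _ _ hp'.1
  · exact hB.isRefl _ _ hp'.2
  · exact hB.isRefl _ _ hq'.1
  · exact hB.isRefl _ _ hq'.2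

/-- Multiplying the members of an orthonormal basis by phases gives an orthonormal basis. -/
lemma OrthonormalBasis.exists_smul_eq {ι E : Type*} [Fintype ι] [NormedAddCommGroup E]
    [InnerProductSpace ℂ E] (b : OrthonormalBasis ι ℂ E) (w : ι → ℂ) (hw : ∀ i, ‖w i‖ = 1) :
    ∃ b' : OrthonormalBasis ι ℂ E, ∀ i, b' i = w i • b i := by
  have hfd : FiniteDimensional ℂ E := b.toBasis.finiteDimensional_of_finite
  obtain ⟨b', hb'⟩ := Orthonormal.exists_orthonormalBasis_extension_of_card_eq (𝕜 := ℂ)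
    (Module.finrank_eq_card_basis b.toBasis) (v := fun i => w i • b i) (s := Set.univ) (by
      refine ⟨fun i => by simp [norm_smul, hw], fun i j hij => ?_⟩
      have : inner ℂ (b i) (b j) = 0 := b.orthonormal.2 fun h => hij (Subtype.ext h)
      simp [inner_smul_left, inner_smul_right, this])
  exact ⟨b', fun i => hb' i trivial⟩

/-- The linear functional on the exterior algebra of `V 5` reading off the coefficient of the
volume element. -/
def volCoeff : ExteriorAlgebra ℂ (V 5) →ₗ[ℂ] ℂ :=
  liftAlternating (Pi.single 5 (EuclideanSpace.basisFun (Fin 5) ℂ).toBasis.det)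

lemma volCoeff_basis_ne_zero (b : OrthonormalBasis (Fin 5) ℂ (V 5)) :
    volCoeff (ι ℂ (b 0) * (ι ℂ (b 1) * (ι ℂ (b 2) * (ι ℂ (b 3) * ι ℂ (b 4))))) ≠ 0 := by
  have h : ι ℂ (b 0) * (ι ℂ (b 1) * (ι ℂ (b 2) * (ι ℂ (b 3) * ι ℂ (b 4)))) =
      ιMulti ℂ 5 b := by
    simp [ιMulti_apply]
    rfl
  rw [h, volCoeff, liftAlternating_apply_ιMulti, Pi.single_eq_same]
  have := (EuclideanSpace.basisFun (Fin 5) ℂ).toBasis.isUnit_det b.toBasis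
  rw [b.coe_toBasis] at this
  exact this.ne_zero

/-- The bilinear form `(x, y) ↦ volCoeff (ψ ∧ x ∧ y)`. -/
def wedgeForm (ψ : ExteriorAlgebra ℂ (V 5)) : V 5 →ₗ[ℂ] V 5 →ₗ[ℂ] ℂ :=
  LinearMap.mk₂ ℂ (fun x y => volCoeff (ψ * (ι ℂ x * ι ℂ y)))
    (fun x x' y => by simp [add_mul, mul_add]) (fun c x y => by simp)
    (fun x y y' => by simp [mul_add]) (fun c x y => by simp)

lemma wedgeForm_apply (ψ : ExteriorAlgebra ℂ (V 5)) (x y : V 5) :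
    wedgeForm ψ x y = volCoeff (ψ * (ι ℂ x * ι ℂ y)) := rfl

lemma wedgeForm_isAlt (ψ : ExteriorAlgebra ℂ (V 5)) : (wedgeForm ψ).IsAlt := fun x => by
  simp [wedgeForm_apply]

/-- A 3-vector in dimension five is recovered from its wedge form in any orthonormal basis. -/
lemma volCoeff_smul_eq (b : OrthonormalBasis (Fin 5) ℂ (V 5)) (ψ : ExteriorAlgebra ℂ (V 5))
    (hψ : ψ ∈ ⋀[ℂ]^3 (V 5)) :
    volCoeff (ι ℂ (b 0) * (ι ℂ (b 1) * (ι ℂ (b 2) * (ι ℂ (b 3) * ι ℂ (b 4))))) • ψ =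
      wedgeForm ψ (b 3) (b 4) • (ι ℂ (b 0) * (ι ℂ (b 1) * ι ℂ (b 2)))
      - wedgeForm ψ (b 2) (b 4) • (ι ℂ (b 0) * (ι ℂ (b 1) * ι ℂ (b 3)))
      + wedgeForm ψ (b 2) (b 3) • (ι ℂ (b 0) * (ι ℂ (b 1) * ι ℂ (b 4)))
      + wedgeForm ψ (b 1) (b 4) • (ι ℂ (b 0) * (ι ℂ (b 2) * ι ℂ (b 3)))
      - wedgeForm ψ (b 1) (b 3) • (ι ℂ (b 0) * (ι ℂ (b 2) * ι ℂ (b 4)))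
      + wedgeForm ψ (b 1) (b 2) • (ι ℂ (b 0) * (ι ℂ (b 3) * ι ℂ (b 4)))
      - wedgeForm ψ (b 0) (b 4) • (ι ℂ (b 1) * (ι ℂ (b 2) * ι ℂ (b 3)))
      + wedgeForm ψ (b 0) (b 3) • (ι ℂ (b 1) * (ι ℂ (b 2) * ι ℂ (b 4)))
      - wedgeForm ψ (b 0) (b 2) • (ι ℂ (b 1) * (ι ℂ (b 3) * ι ℂ (b 4)))
      + wedgeForm ψ (b 0) (b 1) • (ι ℂ (b 2) * (ι ℂ (b 3) * ι ℂ (b 4))) := by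
  have hspan : Submodule.span ℂ (Set.range b) = ⊤ := by
    rw [← b.coe_toBasis, b.toBasis.span_eq]
  rw [← exteriorPower.ιMulti_family_span_fixedDegree_of_span ℂ hspan] at hψ
  simp only [wedgeForm_apply]
  induction hψ using Submodule.span_induction with
  | zero => simp
  | add φ χ _ _ hφ hχ =>
    rw [smul_add, hφ, hχ]
    simp only [add_mul, map_add, add_smul]
    abel
  | smul c φ _ hφ =>
    rw [smul_comm, hφ]
    simp only [smul_mul_assoc, map_smul, smul_eq_mul, mul_smul, smul_add, smul_sub]
  | mem φ hφ =>
    obtain ⟨s, rfl⟩ := hφ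
    obtain ⟨i, j, k, hij, hjk, hijk⟩ : ∃ i j k : Fin 5, i < j ∧ j < k ∧
        ExteriorAlgebra.ιMulti_family ℂ 3 b s = ι ℂ (b i) * (ι ℂ (b j) * ι ℂ (b k)) := by
      let e := Set.powersetCard.ofFinEmbEquiv.symm s
      refine ⟨e 0, e 1, e 2, e.strictMono (by decide), e.strictMono (by decide), ?_⟩
      simp only [ExteriorAlgebra.ιMulti_family, ιMulti_succ_apply, ιMulti_zero_apply, mul_one]
      rfl
    rw [hijk]
    have anti : ∀ i j : Fin 5, ι ℂ (b i) * ι ℂ (b j) = -(ι ℂ (b j) * ι ℂ (b i)) :=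
      fun i j => eq_neg_of_add_eq_zero_left (ι_add_mul_swap (b i) (b j))
    have anti_mul : ∀ (i j : Fin 5) z, ι ℂ (b i) * (ι ℂ (b j) * z) =
        -(ι ℂ (b j) * (ι ℂ (b i) * z)) := fun i j z => by
      rw [← mul_assoc, anti, neg_mul, mul_assoc]
    have sq_mul : ∀ (i : Fin 5) z, ι ℂ (b i) * (ι ℂ (b i) * z) = 0 := fun i z => by
      rw [← mul_assoc, ι_sq_zero, zero_mul]
    clear hijk
    fin_cases i <;> fin_cases j <;> first | exact absurd hij (by decide) | skip
    all_goals fin_cases k <;> first | exact absurd hjk (by decide) | skip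
    all_goals
      simp [mul_assoc, sq_mul, anti 2 1, anti 3 1, anti 4 1, anti 3 2, anti 4 2, anti 4 3,
        anti_mul 1 0, anti_mul 2 0, anti_mul 3 0, anti_mul 4 0, anti_mul 2 1, anti_mul 3 1,
        anti_mul 4 1, anti_mul 3 2, anti_mul 4 2, anti_mul 4 3]

/-- Polar decomposition of a complex number. -/
lemma Complex.exists_norm_eq_one_mul (a : ℂ) : ∃ u : ℂ, ‖u‖ = 1 ∧ a = (‖a‖ : ℂ) * u :=
  ⟨Complex.exp (Complex.arg a * Complex.I), Complex.norm_exp_ofReal_mul_I _,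
    (Complex.norm_mul_exp_arg_mul_I a).symm⟩

/-- (Existence of the canonical form for 3-vectors in
dimension 5.) Every `ψ ∈ ⋀³ V`, `dim V = 5`, is LU-equivalent to
`(c₁ · e₁ ∧ e₂ + c₂ · e₃ ∧ e₄) ∧ e₅` with `c₁ ≥ c₂ ≥ 0`. -/
theorem three_vector_dim5_canonical_form_exists
    (ψ : ExteriorAlgebra ℂ (V 5)) (hψ : ψ ∈ ⋀[ℂ]^3 (V 5)) :
    ∃ (U : V 5 ≃ₗᵢ[ℂ] V 5) (c₁ c₂ : ℝ), c₂ ≤ c₁ ∧ 0 ≤ c₂ ∧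
      luMap 5 U ψ =
        ((c₁ : ℂ) • (ExteriorAlgebra.ι ℂ (stdVec 5 1) * ExteriorAlgebra.ι ℂ (stdVec 5 2)) +
         (c₂ : ℂ) • (ExteriorAlgebra.ι ℂ (stdVec 5 3) * ExteriorAlgebra.ι ℂ (stdVec 5 4))) *
        ExteriorAlgebra.ι ℂ (stdVec 5 5) := by
  obtain ⟨b, hle, h02, h03, h04, h12, h13, h14, h24, h34⟩ :=
    exists_orthonormalBasis_isAlt (wedgeForm ψ) (wedgeForm_isAlt ψ)
  have hexp := volCoeff_smul_eq b ψ hψ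
  have hδ := volCoeff_basis_ne_zero b
  set δ := volCoeff (ι ℂ (b 0) * (ι ℂ (b 1) * (ι ℂ (b 2) * (ι ℂ (b 3) * ι ℂ (b 4)))))
  simp only [h02, h03, h04, h12, h13, h14, h24, h34, zero_smul, sub_zero, add_zero,
    zero_add] at hexp
  rw [← eq_inv_smul_iff₀ hδ, smul_add, smul_smul, smul_smul] at hexp
  obtain ⟨u, hu, hau⟩ := Complex.exists_norm_eq_one_mul (δ⁻¹ * wedgeForm ψ (b 2) (b 3))
  obtain ⟨v, hv, hav⟩ := Complex.exists_norm_eq_one_mul (δ⁻¹ * wedgeForm ψ (b 0) (b 1))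
  obtain ⟨b', hb'⟩ := b.exists_smul_eq ![u, 1, v, 1, 1] (by
    intro i
    fin_cases i <;> simp [hu, hv])
  have hU : ∀ (i : Fin 5) (n : ℕ), n = i + 1 → b'.repr (b' i) = stdVec 5 n := by
    rintro i n rfl
    rw [b'.repr_self, stdVec, dif_pos ⟨by omega, by omega⟩]
    rfl
  refine ⟨b'.repr, ‖δ⁻¹ * wedgeForm ψ (b 2) (b 3)‖, ‖δ⁻¹ * wedgeForm ψ (b 0) (b 1)‖, ?_,
    norm_nonneg _, ?_⟩
  · rw [norm_mul, norm_mul]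
    gcongr
  · have hψ' : ψ = ((‖δ⁻¹ * wedgeForm ψ (b 2) (b 3)‖ : ℂ) • (ι ℂ (b' 0) * ι ℂ (b' 1)) +
        (‖δ⁻¹ * wedgeForm ψ (b 0) (b 1)‖ : ℂ) • (ι ℂ (b' 2) * ι ℂ (b' 3))) * ι ℂ (b' 4) := by
      rw [hau, hav] at hexp
      refine hexp.trans ?_
      simp [hb', add_mul, mul_assoc, smul_smul]
    have hmap : ∀ x, luMap 5 b'.repr (ι ℂ x) = ι ℂ (b'.repr x) := fun x => by
      simp [luMap]
    rw [← hU 0 1 rfl, ← hU 1 2 rfl, ← hU 2 3 rfl, ← hU 3 4 rfl, ← hU 4 5 rfl]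
    conv_lhs => rw [hψ']
    simp only [map_mul, map_add, map_smul, hmap]
end
end

section
/- Let V be a complex inner product space of dimension M ≥ 4 with a fixed orthonormal basis e_1, …, e_M, and let N = 2. Then every ψ ∈ ⋀²V is LU-equivalent to a single occupancy vector: there exists a unitary operator U on V such that (⋀²U) ψ ∈ 𝒮. -/
open ExteriorAlgebra Finset

noncomputable section

open scoped InnerProductSpace

/-- A linear map into a space of smaller dimension kills a unit vector. -/
theorem exists_norm_eq_one_map_eq_zero {E : Type} [NormedAddCommGroup E] [InnerProductSpace ℂ E]
    [FiniteDimensional ℂ E] {m : ℕ} (hm : m < Module.finrank ℂ E)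
    (φ : Fin m → E →ₗ[ℂ] ℂ) : ∃ x : E, ‖x‖ = 1 ∧ ∀ i, φ i x = 0 := by
  have h : LinearMap.ker (LinearMap.pi φ) ≠ ⊥ :=
    LinearMap.ker_ne_bot_of_finrank_lt (by simpa using hm)
  obtain ⟨x, hx, hx0⟩ := (Submodule.ne_bot_iff _).1 h
  refine ⟨((‖x‖⁻¹ : ℝ) : ℂ) • x, ?_, fun i => ?_⟩
  · rw [norm_smul]
    simp [norm_ne_zero_iff.2 hx0]
  · have : φ i x = 0 := congrFun (LinearMap.mem_ker.1 hx) i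
    simp [this]

/-- Every bilinear form on a finite-dimensional inner product space is represented by a
conjugate-linear operator. -/
theorem exists_conjLinear_inner_eq {E : Type} [NormedAddCommGroup E] [InnerProductSpace ℂ E]
    [FiniteDimensional ℂ E] (B : E →ₗ[ℂ] E →ₗ[ℂ] ℂ) :
    ∃ C : E →ₗ⋆[ℂ] E, ∀ x y, ⟪C x, y⟫_ℂ = B x y := by
  have : CompleteSpace E := FiniteDimensional.complete ℂ E
  refine ⟨(InnerProductSpace.toDual ℂ E).symm.toLinearEquiv.toLinearMap.comp
    (LinearMap.toContinuousLinearMap.toLinearMap.comp B), fun x y => ?_⟩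
  simp

/-- A four-dimensional space with an alternating form has an orthonormal basis in which the first
two and the last two vectors are pairwise isotropic. -/
theorem exists_orthonormal_pairs_of_finrank_eq_four {E : Type} [NormedAddCommGroup E]
    [InnerProductSpace ℂ E] [FiniteDimensional ℂ E] (hE : Module.finrank ℂ E = 4)
    (B : E →ₗ[ℂ] E →ₗ[ℂ] ℂ) (hB : ∀ x, B x x = 0) :
    ∃ b : Fin 4 → E, Orthonormal ℂ b ∧ B (b 0) (b 1) = 0 ∧ B (b 2) (b 3) = 0 := by
  obtain ⟨C, hC⟩ := exists_conjLinear_inner_eq B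
  have : Nontrivial E := Module.nontrivial_of_finrank_pos (R := ℂ) (by omega)
  obtain ⟨μ, hμ⟩ := Module.End.exists_eigenvalue (C.comp C : E →ₗ[ℂ] E)
  obtain ⟨x, hx⟩ := hμ.exists_hasEigenvector
  have hx0 := hx.2
  have hCx : C (C x) = μ • x := hx.apply_eq_smul
  set f : E := ((‖x‖⁻¹ : ℝ) : ℂ) • x with hf
  have hf1 : ‖f‖ = 1 := by
    rw [hf, norm_smul]
    simp [norm_ne_zero_iff.2 hx0]
  have hCf : C (C f) = μ • f := by
    simp [hf, hCx, smul_comm μ]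
  have build : ∀ p q r s : E, ‖p‖ = 1 → ‖q‖ = 1 → ‖r‖ = 1 → ‖s‖ = 1 → ⟪p, q⟫_ℂ = 0 →
      ⟪p, r⟫_ℂ = 0 → ⟪p, s⟫_ℂ = 0 → ⟪q, r⟫_ℂ = 0 → ⟪q, s⟫_ℂ = 0 → ⟪r, s⟫_ℂ = 0 →
      B p q = 0 → B r s = 0 →
      ∃ b : Fin 4 → E, Orthonormal ℂ b ∧ B (b 0) (b 1) = 0 ∧ B (b 2) (b 3) = 0 := by
    intro p q r s hp hq hr hs hpq hpr hps hqr hqs hrs h1 h2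
    refine ⟨![p, q, r, s], ⟨fun i => ?_, fun i j hij => ?_⟩, h1, h2⟩
    · fin_cases i <;> simpa
    · fin_cases i <;> fin_cases j <;>
        first
        | exact absurd rfl hij
        | simpa
        | (refine inner_eq_zero_symm.1 ?_; simpa)
  by_cases h0 : C f = 0
  · obtain ⟨r, hr, hr'⟩ := exists_norm_eq_one_map_eq_zero (m := 1) (by omega) ![innerₛₗ ℂ f]
    obtain ⟨s, hs, hs'⟩ := exists_norm_eq_one_map_eq_zero (m := 3) (by omega)
      ![innerₛₗ ℂ f, innerₛₗ ℂ r, B r]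
    obtain ⟨q, hq, hq'⟩ := exists_norm_eq_one_map_eq_zero (m := 3) (by omega)
      ![innerₛₗ ℂ f, innerₛₗ ℂ r, innerₛₗ ℂ s]
    simp only [Fin.forall_fin_succ] at hr' hs' hq'
    simp at hr' hs' hq'
    exact build f q r s hf1 hq hr hs hq'.1 hr' hs'.1 (inner_eq_zero_symm.1 hq'.2.1)
      (inner_eq_zero_symm.1 hq'.2.2) hs'.2.1 (by rw [← hC, h0, inner_zero_left]) hs'.2.2
  · set r : E := ((‖C f‖⁻¹ : ℝ) : ℂ) • C f with hr
    have hr1 : ‖r‖ = 1 := by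
      rw [hr, norm_smul]
      simp [norm_ne_zero_iff.2 h0]
    have hfr : ⟪f, r⟫_ℂ = 0 := by
      rw [hr, inner_smul_right, inner_eq_zero_symm.1 ((hC f f).trans (hB f)), mul_zero]
    have hCfr : C f = (‖C f‖ : ℂ) • r := by
      rw [hr, smul_smul]
      simp [norm_ne_zero_iff.2 h0]
    obtain ⟨q, hq, hq'⟩ := exists_norm_eq_one_map_eq_zero (m := 2) (by omega)
      ![innerₛₗ ℂ f, innerₛₗ ℂ r]
    obtain ⟨s, hs, hs'⟩ := exists_norm_eq_one_map_eq_zero (m := 3) (by omega)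
      ![innerₛₗ ℂ f, innerₛₗ ℂ r, innerₛₗ ℂ q]
    simp only [Fin.forall_fin_succ] at hs' hq'
    simp at hs' hq'
    refine build f q r s hf1 hq hr1 hs hq'.1 hfr hs'.1 (inner_eq_zero_symm.1 hq'.2)
      hs'.2.2 hs'.2.1 ?_ ?_
    · rw [← hC, hCfr, inner_smul_left, hq'.2, mul_zero]
    · rw [← hC, hr, map_smulₛₗ, hCf, inner_smul_left, inner_smul_left, hs'.1]
      simp

theorem Orthonormal.finCons {E : Type} [NormedAddCommGroup E] [InnerProductSpace ℂ E] {n : ℕ}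
    {b : Fin n → E} (hb : Orthonormal ℂ b) {x : E} (hx : ‖x‖ = 1) (h : ∀ i, ⟪x, b i⟫_ℂ = 0) :
    Orthonormal ℂ (Fin.cons x b : Fin (n + 1) → E) := by
  refine ⟨fun i => ?_, fun i j hij => ?_⟩
  · cases i using Fin.cases <;> simp [hx, hb.1]
  · cases i using Fin.cases <;> cases j using Fin.cases
    · exact absurd rfl hij
    · simpa using h _
    · simpa using inner_eq_zero_symm.1 (h _)
    · simpa using hb.2 fun e => hij (congrArg Fin.succ e)

/-- Unless the dimension is two, an alternating form on a finite-dimensional inner product space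
admits an orthonormal basis whose consecutive disjoint pairs are isotropic. -/
theorem exists_orthonormal_pairs (n : ℕ) (hn : n ≠ 2) {E : Type} [NormedAddCommGroup E]
    [InnerProductSpace ℂ E] [FiniteDimensional ℂ E] (hE : Module.finrank ℂ E = n)
    (B : E →ₗ[ℂ] E →ₗ[ℂ] ℂ) (hB : ∀ x, B x x = 0) :
    ∃ b : Fin n → E, Orthonormal ℂ b ∧
      ∀ i j : Fin n, Even (i : ℕ) → (j : ℕ) = i + 1 → B (b i) (b j) = 0 := by
  induction n using Nat.strong_induction_on generalizing E with
  | _ n ih =>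
  by_cases h1 : n ≤ 1
  · let b := (stdOrthonormalBasis ℂ E).reindex (finCongr hE)
    exact ⟨b, b.orthonormal, fun i j _ hij => absurd j.2 (by omega)⟩
  by_cases h4 : n = 4
  · subst h4
    obtain ⟨b, hb, h01, h23⟩ := exists_orthonormal_pairs_of_finrank_eq_four hE B hB
    refine ⟨b, hb, fun i j hi hij => ?_⟩
    rw [Nat.even_iff] at hi
    obtain ⟨rfl, rfl⟩ | ⟨rfl, rfl⟩ : (i = 0 ∧ j = 1) ∨ (i = 2 ∧ j = 3) := by
      simp only [Fin.ext_iff, Fin.val_zero, Fin.val_one, Fin.val_two,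
        show ((3 : Fin 4) : ℕ) = 3 from rfl]
      omega
    · exact h01
    · exact h23
  obtain ⟨m, rfl⟩ : ∃ m, n = m + 2 := ⟨n - 2, by omega⟩
  obtain ⟨p, hp, -⟩ := exists_norm_eq_one_map_eq_zero (E := E) (m := 0) (by omega) ![]
  obtain ⟨q, hq, hq'⟩ := exists_norm_eq_one_map_eq_zero (m := 2) (by omega)
    ![innerₛₗ ℂ p, B p]
  simp only [Fin.forall_fin_succ] at hq'
  simp at hq'
  have hpq : Orthonormal ℂ ![p, q] := by
    simpa [hp, hq] using hq'.1
  let S : Submodule ℂ E := (Submodule.span ℂ (Set.range ![p, q]))ᗮ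
  have hS : Module.finrank ℂ S = m := by
    have h := Submodule.finrank_add_finrank_orthogonal (Submodule.span ℂ (Set.range ![p, q]))
    rw [finrank_span_eq_card hpq.linearIndependent, hE, Fintype.card_fin] at h
    change Module.finrank ℂ (Submodule.span ℂ (Set.range ![p, q]))ᗮ = m
    omega
  obtain ⟨b, hb, hb'⟩ := ih m (by omega) (by omega) hS (B.domRestrict₁₂ S S) fun x => hB x
  have hbS : ∀ (k : Fin 2) (i : Fin m), ⟪![p, q] k, (b i : E)⟫_ℂ = 0 := fun k i =>
    (Submodule.mem_orthogonal _ _).1 (b i).2 _ (Submodule.subset_span ⟨k, rfl⟩)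
  have hbE : Orthonormal ℂ fun i => (b i : E) := hb.comp_linearIsometry S.subtypeₗᵢ
  refine ⟨Fin.cons p (Fin.cons q fun i => (b i : E)),
    (hbE.finCons hq (hbS 1)).finCons hp fun i => ?_, fun i j hi hij => ?_⟩
  · cases i using Fin.cases
    · simpa using hq'.1
    · simpa using hbS 0 _
  · cases i using Fin.cases with
    | zero =>
      obtain rfl : j = 1 := Fin.ext (by simpa using hij)
      simpa using hq'.2
    | succ i =>
    cases i using Fin.cases with
    | zero => simp at hi
    | succ i =>
    cases j using Fin.cases with
    | zero => simp at hij
    | succ j =>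
    cases j using Fin.cases with
    | zero => simp at hij
    | succ j =>
    exact hb' i j (by simpa [Nat.even_add_one] using hi) (by simpa using hij)

/-- A bivector determines an alternating form whose values on an orthonormal basis are, up to
conjugation, its coordinates in that basis. -/
theorem exists_alternating_two_smul_luMap_eq_sum (M : ℕ) (ψ : ExteriorAlgebra ℂ (V M))
    (hψ : ψ ∈ ⋀[ℂ]^2 (V M)) :
    ∃ B : V M →ₗ[ℂ] V M →ₗ[ℂ] ℂ, (∀ x, B x x = 0) ∧
      ∀ b : OrthonormalBasis (Fin M) ℂ (V M), (2 : ℂ) • luMap M b.repr ψ =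
        ∑ i, ∑ j, starRingEnd ℂ (B (b i) (b j)) •
          (ι ℂ (EuclideanSpace.single i 1 : V M) * ι ℂ (EuclideanSpace.single j 1 : V M)) := by
  rw [exteriorPower, pow_two] at hψ
  induction hψ using Submodule.mul_induction_on' with
  | mem_mul_mem u hu v hv =>
    obtain ⟨x, rfl⟩ := hu
    obtain ⟨y, rfl⟩ := hv
    refine ⟨LinearMap.mk₂ ℂ (fun u v => ⟪x, u⟫_ℂ * ⟪y, v⟫_ℂ - ⟪x, v⟫_ℂ * ⟪y, u⟫_ℂ)
      ?_ ?_ ?_ ?_, fun u => ?_, fun b => ?_⟩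
    · intros; simp only [inner_add_right]; ring
    · intros; simp only [inner_smul_right, smul_eq_mul]; ring
    · intros; simp only [inner_add_right]; ring
    · intros; simp only [inner_smul_right, smul_eq_mul]; ring
    · simp only [LinearMap.mk₂_apply]; ring
    · have expand : ∀ z : V M, ι ℂ (b.repr z) =
          ∑ i, ⟪b i, z⟫_ℂ • ι ℂ (EuclideanSpace.single i 1 : V M) := fun z => by
        conv_lhs => rw [← (EuclideanSpace.basisFun (Fin M) ℂ).sum_repr (b.repr z)]
        simp [b.repr_apply_apply]
      have swap : ι ℂ (b.repr y) * ι ℂ (b.repr x) = -(ι ℂ (b.repr x) * ι ℂ (b.repr y)) :=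
        eq_neg_of_add_eq_zero_left (ι_add_mul_swap _ _)
      have lhs : (2 : ℂ) • luMap M b.repr (ι ℂ x * ι ℂ y) =
          ι ℂ (b.repr x) * ι ℂ (b.repr y) - ι ℂ (b.repr y) * ι ℂ (b.repr x) := by
        rw [swap, sub_neg_eq_add, ← two_smul ℂ]
        simp [luMap]
      rw [lhs, expand x, expand y, Finset.sum_mul_sum, Finset.sum_mul_sum,
        ← Finset.sum_sub_distrib]
      refine Finset.sum_congr rfl fun i _ => ?_
      rw [← Finset.sum_sub_distrib]
      refine Finset.sum_congr rfl fun j _ => ?_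
      simp only [LinearMap.mk₂_apply, map_sub, map_mul, inner_conj_symm, smul_mul_smul_comm,
        ← sub_smul]
      congr 1
      ring
  | add u hu v hv hBu hBv =>
    obtain ⟨B, hB, hB'⟩ := hBu
    obtain ⟨D, hD, hD'⟩ := hBv
    refine ⟨B + D, fun x => by simp [hB, hD], fun b => ?_⟩
    simp [hB', hD', add_smul, Finset.sum_add_distrib]

theorem ι_single_mul_ι_single_mem_SOV {M : ℕ} {i j : Fin M} (hij : i < j)
    (h : ¬(Even (i : ℕ) ∧ (j : ℕ) = i + 1)) :
    ι ℂ (EuclideanSpace.single i 1 : V M) * ι ℂ (EuclideanSpace.single j 1 : V M) ∈ SOV M 2 := by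
  have hij' : (i : ℕ) < j := hij
  rw [Nat.even_iff] at h
  refine Submodule.subset_span ⟨![i + 1, j + 1], ⟨?_, ?_⟩, ?_, ?_⟩
  · intro k l hkl
    fin_cases k <;> fin_cases l <;> simp_all
  · intro k
    fin_cases k <;> simp
  · intro k l hkl
    fin_cases k <;> fin_cases l <;> simp_all <;> omega
  · have hs : ∀ k : Fin M, stdVec M (k + 1) = EuclideanSpace.single k 1 := fun k => by
      rw [stdVec, dif_pos ⟨by omega, by omega⟩]
      rfl
    simp [wedge, ιMulti_apply, Matrix.vecTail, hs]

/-- For `N = 2` and `M ≥ 4`, every `ψ ∈ ⋀² V` is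
LU-equivalent to a single occupancy vector. -/
theorem sov_universal_two_fermions (M : ℕ) (hM : 4 ≤ M)
    (ψ : ExteriorAlgebra ℂ (V M)) (hψ : ψ ∈ ⋀[ℂ]^2 (V M)) :
    ∃ U : V M ≃ₗᵢ[ℂ] V M, luMap M U ψ ∈ SOV M 2 := by
  obtain ⟨B, hB, hB'⟩ := exists_alternating_two_smul_luMap_eq_sum M ψ hψ
  obtain ⟨v, hv, hv'⟩ := exists_orthonormal_pairs M (by omega) (by simp) B hB
  have hspan : ⊤ ≤ Submodule.span ℂ (Set.range v) :=
    (hv.linearIndependent.span_eq_top_of_card_eq_finrank' (by simp)).ge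
  let b : OrthonormalBasis (Fin M) ℂ (V M) := OrthonormalBasis.mk hv hspan
  have hb : ∀ i, b i = v i := fun i => by simp [b]
  refine ⟨b.repr, (Submodule.smul_mem_iff _ (two_ne_zero (α := ℂ))).1 ?_⟩
  rw [hB' b]
  have hanti : ∀ x y, B x y = -B y x := fun x y => by
    have h := hB (x + y)
    simp only [map_add, LinearMap.add_apply, hB, zero_add, add_zero] at h
    exact eq_neg_of_add_eq_zero_right h
  refine Submodule.sum_mem _ fun i _ => Submodule.sum_mem _ fun j _ => ?_
  rw [hb, hb]
  rcases lt_trichotomy i j with hij | rfl | hij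
  · by_cases h : Even (i : ℕ) ∧ (j : ℕ) = i + 1
    · simp [hv' i j h.1 h.2]
    · exact Submodule.smul_mem _ _ (ι_single_mul_ι_single_mem_SOV hij h)
  · simp [hB]
  · by_cases h : Even (j : ℕ) ∧ (i : ℕ) = j + 1
    · simp [hanti (v i), hv' j i h.1 h.2]
    · rw [eq_neg_of_add_eq_zero_left (ι_add_mul_swap _ _)]
      exact Submodule.smul_mem _ _ (neg_mem (ι_single_mul_ι_single_mem_SOV hij h))
end
end

section
/- Let V be a complex inner product space of dimension M with a fixed orthonormal basis e_1, …, e_M, and let N ≥ 1. Let W ⊆ ⋀^N V be a complex subspace spanned by a set of basis vectors e_{i_1…i_N} (with i_1 < … < i_N). If dim W < C(M,N) - C(M,2), then W is not universal: there exists ψ ∈ ⋀^N V that is not LU-equivalent to any element of W. -/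
open ExteriorAlgebra Finset

noncomputable section

/-- A set of unitaries lies in the range of a `C¹` family of linear maps over a real vector space
of dimension `n`. -/
def IsParametrizable {M : ℕ} (n : ℕ) (R : Set (V M ≃ₗᵢ[ℂ] V M)) : Prop :=
  ∃ (E : Type) (_ : NormedAddCommGroup E) (_ : NormedSpace ℝ E) (F : E → V M →ₗ[ℂ] V M),
    FiniteDimensional ℝ E ∧ Module.finrank ℝ E = n ∧
    (∀ v i, ContDiff ℝ 1 fun t => F t v i) ∧ ∀ A ∈ R, ∃ t, ∀ v, F t v = A v

theorem sum_coord_smul_single {M : ℕ} (v : V M) :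
    ∑ i, v i • EuclideanSpace.single i (1 : ℂ) = v := by
  ext j
  simp [Pi.single_apply]

theorem isParametrizable_one {M : ℕ} :
    IsParametrizable 0 ({1} : Set (V M ≃ₗᵢ[ℂ] V M)) := by
  refine ⟨Fin 0 → ℝ, inferInstance, inferInstance, fun _ => LinearMap.id, inferInstance,
    by simp, fun _ _ => contDiff_const, ?_⟩
  rintro A rfl
  exact ⟨0, fun _ => rfl⟩

theorem IsParametrizable.mul {M m n : ℕ} {R S : Set (V M ≃ₗᵢ[ℂ] V M)}
    (hR : IsParametrizable m R) (hS : IsParametrizable n S) :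
    IsParametrizable (m + n) {A | ∃ B ∈ R, ∃ C ∈ S, A = B * C} := by
  obtain ⟨E, _, _, F, _, hE, hF, hFR⟩ := hR
  obtain ⟨E', _, _, G, _, hE', hG, hGS⟩ := hS
  refine ⟨E × E', inferInstance, inferInstance, fun t => F t.1 ∘ₗ G t.2, inferInstance,
    by rw [Module.finrank_prod, hE, hE'], fun v i => ?_, ?_⟩
  · have h : (fun t : E × E' => (F t.1 ∘ₗ G t.2) v i) =
        fun t => ∑ j, G t.2 v j * F t.1 (EuclideanSpace.single j 1) i := by
      funext t
      rw [LinearMap.comp_apply]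
      conv_lhs => rw [← sum_coord_smul_single (G t.2 v)]
      simp
    rw [h]
    exact ContDiff.sum fun j _ =>
      ((hG v j).comp contDiff_snd).mul ((hF _ i).comp contDiff_fst)
  · rintro A ⟨B, hB, C, hC, rfl⟩
    obtain ⟨s, hs⟩ := hFR B hB
    obtain ⟨t, ht⟩ := hGS C hC
    exact ⟨(s, t), fun v => by simp [hs, ht]⟩

/-- The plane rotation by the angle `p.1` with relative phase `p.2` in the coordinates `k`, `j`. -/
def givens {M : ℕ} (k j : Fin M) (p : ℝ × ℝ) : V M →ₗ[ℂ] V M where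
  toFun v := WithLp.toLp 2 fun i =>
    if i = k then Real.cos p.1 * v k - Complex.exp (-(p.2 * Complex.I)) * Real.sin p.1 * v j
    else if i = j then Complex.exp (p.2 * Complex.I) * Real.sin p.1 * v k + Real.cos p.1 * v j
    else v i
  map_add' v w := by
    ext i
    simp only [PiLp.add_apply]
    split_ifs <;> ring
  map_smul' c v := by
    ext i
    simp only [PiLp.smul_apply, smul_eq_mul, RingHom.id_apply]
    split_ifs <;> ring

theorem givens_apply {M : ℕ} (k j : Fin M) (p : ℝ × ℝ) (v : V M) (i : Fin M) :
    givens k j p v i =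
      if i = k then Real.cos p.1 * v k - Complex.exp (-(p.2 * Complex.I)) * Real.sin p.1 * v j
      else if i = j then Complex.exp (p.2 * Complex.I) * Real.sin p.1 * v k + Real.cos p.1 * v j
      else v i := rfl

theorem contDiff_givens {M : ℕ} (k j : Fin M) (v : V M) (i : Fin M) :
    ContDiff ℝ 1 fun p => givens k j p v i := by
  have hc : ContDiff ℝ 1 fun p : ℝ × ℝ => (Real.cos p.1 : ℂ) :=
    Complex.ofRealCLM.contDiff.comp (Real.contDiff_cos.comp contDiff_fst)
  have hs : ContDiff ℝ 1 fun p : ℝ × ℝ => (Real.sin p.1 : ℂ) :=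
    Complex.ofRealCLM.contDiff.comp (Real.contDiff_sin.comp contDiff_fst)
  have hp : ContDiff ℝ 1 fun p : ℝ × ℝ => (p.2 : ℂ) * Complex.I :=
    (Complex.ofRealCLM.contDiff.comp contDiff_snd).mul contDiff_const
  simp only [givens_apply]
  split_ifs
  · exact (hc.mul contDiff_const).sub ((hp.neg.cexp.mul hs).mul contDiff_const)
  · exact ((hp.cexp.mul hs).mul contDiff_const).add (hc.mul contDiff_const)
  · exact contDiff_const

theorem rotation_normSq (θ φ : ℝ) (a b : ℂ) :
    Complex.normSq (Real.cos θ * a - Complex.exp (-(φ * Complex.I)) * Real.sin θ * b) +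
      Complex.normSq (Complex.exp (φ * Complex.I) * Real.sin θ * a + Real.cos θ * b) =
    Complex.normSq a + Complex.normSq b := by
  have h1 : Complex.exp (-(φ * Complex.I)) = Real.cos φ - Real.sin φ * Complex.I := by
    rw [← neg_mul, Complex.exp_mul_I, Complex.cos_neg, Complex.sin_neg, Complex.ofReal_cos,
      Complex.ofReal_sin]
    ring
  have h2 : Complex.exp (φ * Complex.I) = Real.cos φ + Real.sin φ * Complex.I := by
    rw [Complex.exp_mul_I, Complex.ofReal_cos, Complex.ofReal_sin]
  have h3 := Real.sin_sq_add_cos_sq θ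
  have h4 := Real.sin_sq_add_cos_sq φ
  rw [h1, h2]
  simp only [Complex.normSq_apply, Complex.add_re, Complex.add_im, Complex.sub_re, Complex.sub_im,
    Complex.mul_re, Complex.mul_im, Complex.ofReal_re, Complex.ofReal_im, Complex.I_re,
    Complex.I_im]
  generalize Real.sin θ = s at *
  generalize Real.cos θ = c at *
  generalize Real.sin φ = x at *
  generalize Real.cos φ = y at *
  linear_combination (a.re ^ 2 + a.im ^ 2 + b.re ^ 2 + b.im ^ 2) * h3 +
    s ^ 2 * (a.re ^ 2 + a.im ^ 2 + b.re ^ 2 + b.im ^ 2) * h4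

theorem norm_givens {M : ℕ} {k j : Fin M} (hkj : k ≠ j) (p : ℝ × ℝ) (v : V M) :
    ‖givens k j p v‖ = ‖v‖ := by
  rw [EuclideanSpace.norm_eq, EuclideanSpace.norm_eq]
  congr 1
  rw [← sub_eq_zero, ← Finset.sum_sub_distrib, Fintype.sum_eq_add k j hkj]
  · have := rotation_normSq p.1 p.2 (v k) (v j)
    simp only [givens_apply, if_true, if_neg hkj.symm, ← Complex.normSq_eq_norm_sq]
    linarith
  · rintro i ⟨hik, hij⟩
    simp [givens_apply, hik, hij]

/-- The plane rotation `givens` as a unitary. -/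
def givensUnitary {M : ℕ} {k j : Fin M} (hkj : k ≠ j) (p : ℝ × ℝ) : V M ≃ₗᵢ[ℂ] V M :=
  LinearIsometry.toLinearIsometryEquiv ⟨givens k j p, norm_givens hkj p⟩ rfl

theorem givensUnitary_apply {M : ℕ} {k j : Fin M} (hkj : k ≠ j) (p : ℝ × ℝ) (v : V M) :
    givensUnitary hkj p v = givens k j p v := rfl

theorem isParametrizable_range_givensUnitary {M : ℕ} {k j : Fin M} (hkj : k ≠ j) :
    IsParametrizable 2 (Set.range (givensUnitary hkj)) := by
  refine ⟨ℝ × ℝ, inferInstance, inferInstance, givens k j, inferInstance, by simp,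
    contDiff_givens k j, ?_⟩
  rintro _ ⟨p, rfl⟩
  exact ⟨p, fun _ => rfl⟩

theorem exists_rotation_eq (a b : ℂ) : ∃ (p : ℝ × ℝ) (w : ℂ),
    Real.cos p.1 * w = a ∧ Complex.exp (p.2 * Complex.I) * Real.sin p.1 * w = b := by
  by_cases ha : a = 0
  · exact ⟨(Real.pi / 2, 0), b, by simp [ha], by simp⟩
  · have hc : (Real.cos (Real.arctan ‖b / a‖) : ℂ) ≠ 0 :=
      Complex.ofReal_ne_zero.2 (Real.cos_arctan_pos _).ne'
    refine ⟨(Real.arctan ‖b / a‖, Complex.arg (b / a)),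
      a / Real.cos (Real.arctan ‖b / a‖), mul_div_cancel₀ _ hc, ?_⟩
    have ht : (Real.sin (Real.arctan ‖b / a‖) : ℂ) =
        ‖b / a‖ * Real.cos (Real.arctan ‖b / a‖) := by
      rw [← Complex.ofReal_mul, Complex.ofReal_inj, ← div_eq_iff (Real.cos_arctan_pos _).ne',
        ← Real.tan_eq_sin_div_cos, Real.tan_arctan]
    have hb := Complex.norm_mul_exp_arg_mul_I (b / a)
    rw [eq_div_iff ha] at hb
    rw [ht]
    field_simp
    linear_combination hb

theorem exists_givens_eq {M : ℕ} {k j : Fin M} (hkj : k ≠ j) (v : V M) :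
    ∃ (p : ℝ × ℝ) (w : V M), givens k j p w = v ∧ w j = 0 ∧
      ∀ i, i ≠ k → i ≠ j → w i = v i := by
  obtain ⟨p, z, hk, hj⟩ := exists_rotation_eq (v k) (v j)
  refine ⟨p, WithLp.toLp 2 fun i => if i = k then z else if i = j then 0 else v i, ?_, ?_, ?_⟩
  · ext i
    rw [givens_apply]
    split_ifs with h1 h2
    · subst h1
      simp [hkj.symm, ← hk]
    · subst h2
      simp [hkj.symm, ← hj]
    · simp [h1, h2]
  · simp [hkj.symm]
  · intro i h1 h2
    simp [h1, h2]

/-- Rotations in the planes `(k, j)`, `j ∈ s`, suffice to annihilate the coordinates in `s`. -/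
theorem exists_isParametrizable_annihilating {M : ℕ} (k : Fin M) (s : Finset (Fin M))
    (hk : k ∉ s) : ∃ R : Set (V M ≃ₗᵢ[ℂ] V M), IsParametrizable (2 * s.card) R ∧
      (∀ H ∈ R, ∀ i, i ≠ k → i ∉ s →
        H (EuclideanSpace.single i 1) = EuclideanSpace.single i 1) ∧
      ∀ v, ∃ H ∈ R, ∃ w, H w = v ∧ (∀ j ∈ s, w j = 0) ∧
        ∀ i, i ≠ k → i ∉ s → w i = v i := by
  induction s using Finset.induction_on with
  | empty =>
    refine ⟨{1}, by simpa using isParametrizable_one, ?_, fun v => ⟨1, rfl, v, rfl, ?_, ?_⟩⟩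
    · rintro H rfl i - -
      rfl
    · simp
    · simp
  | insert j s hj ih =>
    rw [Finset.mem_insert, not_or] at hk
    obtain ⟨R, hR, hfix, hex⟩ := ih hk.2
    refine ⟨{A | ∃ B ∈ Set.range (givensUnitary hk.1), ∃ H ∈ R, A = B * H}, ?_, ?_,
      fun v => ?_⟩
    · rw [Finset.card_insert_of_notMem hj, mul_add, mul_one, add_comm]
      exact (isParametrizable_range_givensUnitary hk.1).mul hR
    · rintro _ ⟨_, ⟨p, rfl⟩, H, hH, rfl⟩ i hik his
      rw [Finset.mem_insert, not_or] at his
      rw [LinearIsometryEquiv.coe_mul, Function.comp_apply, hfix H hH i hik his.2,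
        givensUnitary_apply]
      ext l
      rw [givens_apply]
      split_ifs with h1 h2
      · simp [h1, Ne.symm hik, Ne.symm his.1]
      · simp [h2, Ne.symm hik, Ne.symm his.1]
      · rfl
    · obtain ⟨p, u, hu, huj, hui⟩ := exists_givens_eq hk.1 v
      obtain ⟨H, hH, w, hw, hws, hwi⟩ := hex u
      refine ⟨_, ⟨_, ⟨p, rfl⟩, H, hH, rfl⟩, w, ?_, ?_, ?_⟩
      · rw [LinearIsometryEquiv.coe_mul, Function.comp_apply, hw, givensUnitary_apply, hu]
      · intro i hi
        rcases Finset.mem_insert.1 hi with rfl | hi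
        · rw [hwi i (Ne.symm hk.1) hj, huj]
        · exact hws i hi
      · intro i hik his
        rw [Finset.mem_insert, not_or] at his
        rw [hwi i hik his.2, hui i hik his.1]

theorem apply_single_eq_zero {M : ℕ} (U : V M ≃ₗᵢ[ℂ] V M) {i k : Fin M} (hik : i ≠ k)
    (hi : ∃ c : ℂ, U (EuclideanSpace.single i 1) = c • EuclideanSpace.single i 1) :
    U (EuclideanSpace.single k 1) i = 0 := by
  obtain ⟨c, hc⟩ := hi
  have hc0 : c ≠ 0 := by
    rintro rfl
    rw [zero_smul] at hc
    simpa using congrArg norm hc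
  have h : inner ℂ (U (EuclideanSpace.single i 1)) (U (EuclideanSpace.single k (1 : ℂ))) = 0 := by
    rw [U.inner_map_map]
    rw [EuclideanSpace.inner_single_left]
    simp [hik]
  rw [hc, inner_smul_left, EuclideanSpace.inner_single_left] at h
  simpa [hc0] using h

/-- Every unitary that is diagonal on the first `k` basis vectors is a product of `m * (m - 1) / 2`
plane rotations and a diagonal unitary, where `k + m = M`. -/
theorem exists_isParametrizable_mul_diagonal {M : ℕ} (m : ℕ) : ∀ k, k + m = M →
    ∃ P : Set (V M ≃ₗᵢ[ℂ] V M), IsParametrizable (m * (m - 1)) P ∧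
      ∀ U : V M ≃ₗᵢ[ℂ] V M,
        (∀ i : Fin M, (i : ℕ) < k →
          ∃ c : ℂ, U (EuclideanSpace.single i 1) = c • EuclideanSpace.single i 1) →
        ∃ A ∈ P, ∃ D : V M ≃ₗᵢ[ℂ] V M,
          (∀ i, ∃ c : ℂ, D (EuclideanSpace.single i 1) = c • EuclideanSpace.single i 1) ∧
          U = A * D := by
  induction m with
  | zero =>
    rintro k hk
    refine ⟨{1}, isParametrizable_one, fun U hU => ⟨1, rfl, U, fun i => hU i ?_, ?_⟩⟩
    · have := i.2
      omega
    · rw [one_mul]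
  | succ m ih =>
    intro k hk
    obtain ⟨P, hP, hPex⟩ := ih (k + 1) (by omega)
    let k' : Fin M := ⟨k, by omega⟩
    have hcard : (Finset.Ioi k').card = m := by
      rw [Fin.card_Ioi]
      simp only [k']
      omega
    obtain ⟨R, hR, hfix, hex⟩ :=
      exists_isParametrizable_annihilating k' (Finset.Ioi k') (by simp)
    rw [hcard] at hR
    refine ⟨{A | ∃ B ∈ R, ∃ C ∈ P, A = B * C}, ?_, fun U hU => ?_⟩
    · have h : (m + 1) * (m + 1 - 1) = 2 * m + m * (m - 1) := by
        cases m
        · rfl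
        · simp only [Nat.add_sub_cancel]
          ring
      rw [h]
      exact hR.mul hP
    · obtain ⟨H, hH, w, hw, hws, hwi⟩ := hex (U (EuclideanSpace.single k' 1))
      have hdiag : ∀ i : Fin M, (i : ℕ) < k + 1 → ∃ c : ℂ,
          (H⁻¹ * U) (EuclideanSpace.single i 1) = c • EuclideanSpace.single i 1 := by
        intro i hi
        rcases Nat.lt_succ_iff_lt_or_eq.1 hi with hi | hi
        · obtain ⟨c, hc⟩ := hU i hi
          refine ⟨c, ?_⟩
          rw [LinearIsometryEquiv.coe_mul, Function.comp_apply, hc, map_smul]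
          congr 1
          apply H.injective
          rw [hfix H hH i (by rintro rfl; simp [k'] at hi) (by
            rw [Finset.mem_Ioi, Fin.lt_def]; simp only [k']; omega)]
          exact H.apply_symm_apply _
        · have hik : i = k' := Fin.ext hi
          subst hik
          refine ⟨w k', ?_⟩
          rw [LinearIsometryEquiv.coe_mul, Function.comp_apply, ← hw]
          refine (H.symm_apply_apply w).trans ?_
          ext l
          rcases lt_trichotomy l k' with hl | rfl | hl
          · rw [hwi l hl.ne (by simpa using hl.le), apply_single_eq_zero U hl.ne (hU l hl)]
            simp [hl.ne]
          · simp
          · rw [hws l (Finset.mem_Ioi.2 hl)]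
            simp [hl.ne']
      obtain ⟨A, hA, D, hD, hAD⟩ := hPex (H⁻¹ * U) hdiag
      exact ⟨H * A, ⟨H, hH, A, hA, rfl⟩, D, hD, by rw [mul_assoc, ← hAD, mul_inv_cancel_left]⟩

theorem contDiff_map_exteriorPower {M N : ℕ} {E : Type} [NormedAddCommGroup E] [NormedSpace ℝ E]
    {F : E → V M →ₗ[ℂ] V M} (hF : ∀ v i, ContDiff ℝ 1 fun t => F t v i)
    (f : ExteriorAlgebra ℂ (V M) →ₗ[ℂ] ℂ) {x : ExteriorAlgebra ℂ (V M)}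
    (hx : x ∈ ⋀[ℂ]^N (V M)) :
    ContDiff ℝ 1 fun t => f (ExteriorAlgebra.map (F t) x) := by
  rw [← ExteriorAlgebra.ιMulti_span_fixedDegree] at hx
  induction hx using Submodule.span_induction with
  | mem x hx =>
    obtain ⟨v, rfl⟩ := hx
    have h : (fun t => f (ExteriorAlgebra.map (F t) (ιMulti ℂ N v))) = fun t =>
        ∑ r : Fin N → Fin M, (∏ j, F t (v j) (r j)) *
          f (ιMulti ℂ N fun j => EuclideanSpace.single (r j) 1) := by
      funext t
      rw [ExteriorAlgebra.map_apply_ιMulti]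
      have hv : F t ∘ v = fun j => ∑ i, F t (v j) i • EuclideanSpace.single i (1 : ℂ) := by
        funext j
        rw [sum_coord_smul_single, Function.comp_apply]
      rw [hv, ← AlternatingMap.coe_multilinearMap, MultilinearMap.map_sum, map_sum]
      refine Finset.sum_congr rfl fun r _ => ?_
      rw [MultilinearMap.map_smul_univ, map_smul, smul_eq_mul]
    rw [h]
    exact ContDiff.sum fun r _ => (contDiff_prod fun j _ => hF (v j) (r j)).mul contDiff_const
  | zero => simpa using contDiff_const
  | add x y _ _ hx hy => simpa using hx.add hy
  | smul c x _ hx => simpa using contDiff_const.mul hx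

theorem stdVec_map_of_diagonal {M : ℕ} (D : V M ≃ₗᵢ[ℂ] V M)
    (hD : ∀ i, ∃ c : ℂ, D (EuclideanSpace.single i 1) = c • EuclideanSpace.single i 1) (n : ℕ) :
    ∃ c : ℂ, D (stdVec M n) = c • stdVec M n := by
  unfold stdVec
  split_ifs
  · exact hD _
  · exact ⟨0, by simp⟩

theorem luMap_mem_of_diagonal {M N : ℕ} (D : V M ≃ₗᵢ[ℂ] V M)
    (hD : ∀ i, ∃ c : ℂ, D (EuclideanSpace.single i 1) = c • EuclideanSpace.single i 1)
    {S : Set (Fin N → ℕ)} {x : ExteriorAlgebra ℂ (V M)}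
    (hx : x ∈ Submodule.span ℂ {x | ∃ i ∈ S, x = wedge M N i}) :
    luMap M D x ∈ Submodule.span ℂ {x | ∃ i ∈ S, x = wedge M N i} := by
  induction hx using Submodule.span_induction with
  | mem x hx =>
    obtain ⟨i, hi, rfl⟩ := hx
    choose c hc using stdVec_map_of_diagonal D hD
    have h : luMap M D (wedge M N i) = (∏ j, c (i j)) • wedge M N i := by
      unfold luMap wedge
      rw [ExteriorAlgebra.map_apply_ιMulti, ← AlternatingMap.map_smul_univ]
      congr 1
      funext j
      exact hc (i j)
    rw [h]
    exact Submodule.smul_mem _ _ (Submodule.subset_span ⟨i, hi, rfl⟩)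
  | zero => simp
  | add x y _ _ hx hy => simpa using add_mem hx hy
  | smul c x _ hx => simpa using Submodule.smul_mem _ c hx

theorem luMap_mul_apply {M : ℕ} (A B : V M ≃ₗᵢ[ℂ] V M) (x : ExteriorAlgebra ℂ (V M)) :
    luMap M (A * B) x = luMap M A (luMap M B x) :=
  (AlgHom.congr_fun (ExteriorAlgebra.map_comp_map
    B.toLinearEquiv.toLinearMap A.toLinearEquiv.toLinearMap) x).symm

theorem luMap_inv_luMap {M : ℕ} (U : V M ≃ₗᵢ[ℂ] V M) (x : ExteriorAlgebra ℂ (V M)) :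
    luMap M U⁻¹ (luMap M U x) = x := by
  rw [← luMap_mul_apply, inv_mul_cancel]
  exact AlgHom.congr_fun ExteriorAlgebra.map_id x

/-- If a subspace `W ⊆ ⋀^N V` spanned by a set of basis
vectors `e_{i₁…i_N}` has dimension less than `C(M,N) - C(M,2)`, then `W` is
not universal: some `ψ ∈ ⋀^N V` is not LU-equivalent to any element of `W`. -/
theorem small_basis_span_not_universal (M N : ℕ) (hN : 1 ≤ N)
    (S : Set (Fin N → ℕ)) (hS : ∀ i ∈ S, IsBasisIndex M N i)
    (W : Submodule ℂ (ExteriorAlgebra ℂ (V M)))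
    (hW : W = Submodule.span ℂ {x | ∃ i ∈ S, x = wedge M N i})
    (hdim : Module.finrank ℂ W < Nat.choose M N - Nat.choose M 2) :
    ∃ ψ ∈ ⋀[ℂ]^N (V M), ¬∃ U : V M ≃ₗᵢ[ℂ] V M, luMap M U ψ ∈ W := by
  have hWle : W ≤ ⋀[ℂ]^N (V M) := by
    rw [hW, Submodule.span_le]
    rintro _ ⟨i, -, rfl⟩
    exact ExteriorAlgebra.ιMulti_range ℂ N ⟨_, rfl⟩
  obtain ⟨P, ⟨E, _, _, F, _, hE, hF, hFP⟩, hP⟩ :=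
    exists_isParametrizable_mul_diagonal (M := M) M 0 (Nat.zero_add M)
  have hfin : Module.finrank ℂ (⋀[ℂ]^N (V M)) = M.choose N := by
    rw [exteriorPower.finrank_eq, finrank_euclideanSpace_fin]
  let b := Module.finBasisOfFinrankEq ℂ (⋀[ℂ]^N (V M)) hfin
  obtain ⟨f, hf⟩ := LinearMap.exists_extend b.equivFun.toLinearMap
  have hfx : ∀ x : ⋀[ℂ]^N (V M), f x = b.equivFun x := fun x => LinearMap.congr_fun hf x
  have : FiniteDimensional ℂ W := Submodule.finiteDimensional_of_le hWle
  let w := Module.finBasis ℂ W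
  let g : E × (Fin (Module.finrank ℂ W) → ℂ) → (Fin (M.choose N) → ℂ) := fun q =>
    ∑ l, q.2 l • f (ExteriorAlgebra.map (F q.1) (w l))
  have hg : ContDiff ℝ 1 g := by
    rw [contDiff_pi]
    intro a
    have h : (fun q => g q a) = fun q => ∑ l, q.2 l *
        (LinearMap.proj a ∘ₗ f) (ExteriorAlgebra.map (F q.1) (w l)) := by
      funext q
      simp [g]
    rw [h]
    refine ContDiff.sum fun l _ => ContDiff.mul ?_ ?_
    · exact (contDiff_apply ℝ ℂ l).comp contDiff_snd
    · exact (contDiff_map_exteriorPower hF (LinearMap.proj a ∘ₗ f) (hWle (w l).2)).comp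
        contDiff_fst
  have hrank : Module.finrank ℝ (E × (Fin (Module.finrank ℂ W) → ℂ)) <
      Module.finrank ℝ (Fin (M.choose N) → ℂ) := by
    have h2 : 2 * M.choose 2 = M * (M - 1) := by
      rw [Nat.choose_two_right, Nat.mul_div_cancel' (Nat.even_mul_pred_self M).two_dvd]
    rw [Module.finrank_prod, hE, Module.finrank_pi_fintype, Module.finrank_pi_fintype]
    simp only [Complex.finrank_real_complex, Finset.sum_const, Finset.card_univ, Fintype.card_fin,
      smul_eq_mul]
    omega
  obtain ⟨y, hy⟩ := (hg.dense_compl_range_of_finrank_lt_finrank hrank).nonempty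
  refine ⟨b.equivFun.symm y, Submodule.coe_mem _, ?_⟩
  rintro ⟨U, hU⟩
  obtain ⟨A, hA, D, hD, hAD⟩ := hP U⁻¹ fun i hi => absurd hi (Nat.not_lt_zero _)
  obtain ⟨t, ht⟩ := hFP A hA
  have hFt : F t = A.toLinearEquiv.toLinearMap := LinearMap.ext ht
  set ψ : ExteriorAlgebra ℂ (V M) := ↑(b.equivFun.symm y) with hψ
  obtain ⟨φ, hφW, hφ⟩ : ∃ φ ∈ W, luMap M A φ = ψ := by
    refine ⟨luMap M D (luMap M U ψ), ?_, by rw [← luMap_mul_apply, ← hAD, luMap_inv_luMap]⟩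
    rw [hW] at hU ⊢
    exact luMap_mem_of_diagonal D hD hU
  apply hy
  refine ⟨(t, w.equivFun ⟨φ, hφW⟩), ?_⟩
  have hsum : ∑ l, w.equivFun ⟨φ, hφW⟩ l • (w l : ExteriorAlgebra ℂ (V M)) = φ := by
    have h := congrArg (Submodule.subtype W) (w.sum_equivFun ⟨φ, hφW⟩)
    rwa [map_sum] at h
  calc g (t, w.equivFun ⟨φ, hφW⟩)
      = f (luMap M A (∑ l, w.equivFun ⟨φ, hφW⟩ l • (w l : ExteriorAlgebra ℂ (V M)))) := by
        simp only [g, luMap, hFt, map_sum, map_smul]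
    _ = y := by rw [hsum, hφ, hψ, hfx, LinearEquiv.apply_symm_apply]
end
end

section
/- Let M ≥ 6 be an integer and let K = ⌊M/2⌋. In the polynomial ring ℝ[x_1, …, x_M], the polynomial q_0 := Π_{i=1}^{K} Π_{j ∈ {1,…,M} \ {2i-1, 2i}} (x_{2i-1} + x_{2i} + x_j) does not belong to the ideal I generated by the elementary symmetric polynomials σ_1, …, σ_M of x_1, …, x_M. -/
open MvPolynomial Finset

noncomputable section

/-- The variable `x_n` (1-indexed, `1 ≤ n ≤ M`) of `ℝ[x_1, …, x_M]`;
out-of-range indices give `0`. -/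
def xv (M n : ℕ) : MvPolynomial (Fin M) ℝ :=
  if h : 1 ≤ n ∧ n ≤ M then X (⟨n - 1, by omega⟩ : Fin M) else 0

/-! ### The binary forms `h_n(a + b, -a, -b)` -/

/-- The complete homogeneous symmetric polynomial of degree `n` evaluated at `-a, -b`. -/
def negComplete {R : Type*} [CommRing R] (a b : R) : ℕ → R
  | 0 => 1
  | 1 => -(a + b)
  | n + 2 => -(a + b) * negComplete a b (n + 1) - a * b * negComplete a b n

/-- The complete homogeneous symmetric polynomial of degree `n` evaluated at `T, -a, -b`, as a
polynomial in `T`. -/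
def completePoly {R : Type*} [CommRing R] (a b : R) : ℕ → Polynomial R
  | 0 => 1
  | n + 1 => Polynomial.X * completePoly a b n + Polynomial.C (negComplete a b (n + 1))

/-- The complete homogeneous symmetric polynomial of degree `n` evaluated at `a + b, -a, -b`. -/
def pairForm {R : Type*} [CommRing R] (a b : R) : ℕ → R
  | 0 => 1
  | 1 => 0
  | 2 => a ^ 2 + a * b + b ^ 2
  | n + 3 => (a ^ 2 + a * b + b ^ 2) * pairForm a b (n + 1) + a * b * (a + b) * pairForm a b n

lemma map_pairForm {R S : Type*} [CommRing R] [CommRing S] (f : R →+* S) (a b : R) (n : ℕ) :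
    f (pairForm a b n) = pairForm (f a) (f b) n := by
  induction n using pairForm.induct with
  | case1 => simp [pairForm]
  | case2 => simp [pairForm]
  | case3 => simp [pairForm]
  | case4 n h1 h2 => simp [pairForm, h1, h2]

lemma completePoly_eval_add {R : Type*} [CommRing R] (a b : R) (n : ℕ) :
    (completePoly a b n).eval (a + b) = pairForm a b n := by
  induction n using pairForm.induct with
  | case1 => simp [pairForm, completePoly]
  | case2 => simp [pairForm, completePoly, negComplete]
  | case3 => simp [pairForm, completePoly, negComplete]; ring
  | case4 n h1 h2 =>
    rw [pairForm, ← h1, ← h2]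
    simp only [completePoly, negComplete, Polynomial.eval_add, Polynomial.eval_mul,
      Polynomial.eval_X, Polynomial.eval_C]
    ring

lemma X_pow_eq_mul_completePoly_add {R : Type*} [CommRing R] (a b : R) (n : ℕ) :
    (Polynomial.X : Polynomial R) ^ (n + 2) =
      (Polynomial.X + Polynomial.C a) * (Polynomial.X + Polynomial.C b) * completePoly a b n +
        (Polynomial.C (negComplete a b (n + 1)) * Polynomial.X +
          Polynomial.C (-(a * b * negComplete a b n))) := by
  induction n with
  | zero => simp [completePoly, negComplete]; ring
  | succ n ih =>
    rw [pow_succ, ih]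
    simp only [completePoly, negComplete, map_sub, map_mul, map_neg, map_add]
    ring

/-- If `∏ (T + x_j) = T ^ (n + 2)`, then the product of `x_a + x_b + x_j` over `j ≠ a, b` is a
binary form in `x_a` and `x_b`. -/
lemma prod_add_eq_pairForm {R ι : Type*} [CommRing R] [Fintype ι] [DecidableEq ι] (x : ι → R)
    (n : ℕ) (hx : ∏ j, (Polynomial.X + Polynomial.C (x j)) = Polynomial.X ^ (n + 2))
    {a b : ι} (hab : a ≠ b) :
    ∏ j ∈ Finset.univ \ {a, b}, (x a + x b + x j) = pairForm (x a) (x b) n := by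
  nontriviality R
  set D : Polynomial R :=
    (Polynomial.X + Polynomial.C (x a)) * (Polynomial.X + Polynomial.C (x b)) with hD
  have hDm : D.Monic := (Polynomial.monic_X_add_C _).mul (Polynomial.monic_X_add_C _)
  have hDd : D.degree = 2 := by
    rw [hD, Polynomial.Monic.degree_mul (Polynomial.monic_X_add_C _)]
    simp only [Polynomial.degree_X_add_C]
    norm_num
  have h1 := Polynomial.div_modByMonic_unique (f := Polynomial.X ^ (n + 2)) (g := D)
    (∏ j ∈ Finset.univ \ {a, b}, (Polynomial.X + Polynomial.C (x j))) 0 hDm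
    ⟨by
      rw [zero_add, ← hx, ← Finset.prod_sdiff (Finset.subset_univ {a, b}),
        Finset.prod_pair hab, mul_comm], by
      rw [hDd, Polynomial.degree_zero]; exact WithBot.bot_lt_coe 2⟩
  have h2 := Polynomial.div_modByMonic_unique (f := Polynomial.X ^ (n + 2)) (g := D)
    (completePoly (x a) (x b) n) _ hDm
    ⟨by rw [X_pow_eq_mul_completePoly_add (x a) (x b) n, add_comm], by
      rw [hDd]; exact Polynomial.degree_linear_lt⟩
  have h3 := congrArg (Polynomial.eval (x a + x b)) (h1.1.symm.trans h2.1)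
  rw [completePoly_eval_add, Polynomial.eval_prod] at h3
  simpa using h3

/-! ### Positivity of the coefficients -/

/-- `∑_{j ≤ m} c_j (a b) ^ (m - j) a ^ (2 j + 1)`. -/
def halfForm {R : Type*} [CommRing R] (a b : R) (c : ℕ → ℕ) (m : ℕ) : R :=
  ∑ j ∈ Finset.range (m + 1), (c j : R) * ((a * b) ^ (m - j) * a ^ (2 * j + 1))

lemma halfForm_succ {R : Type*} [CommRing R] (a b : R) (c : ℕ → ℕ) (m : ℕ) :
    halfForm a b c (m + 1) = a * b * halfForm a b c m + c (m + 1) * a ^ (2 * m + 3) := by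
  rw [halfForm, Finset.sum_range_succ, halfForm, Finset.mul_sum]
  congr 1
  · refine Finset.sum_congr rfl fun j hj => ?_
    rw [Nat.succ_sub (Nat.lt_succ_iff.mp (Finset.mem_range.mp hj)), pow_succ]
    ring
  · simp; ring

/-- The antisymmetric form with coefficients `c`. -/
def antiForm {R : Type*} [CommRing R] (a b : R) (c : ℕ → ℕ) (m : ℕ) : R :=
  halfForm a b c m - halfForm b a c m

lemma antiForm_zero {R : Type*} [CommRing R] (a b : R) (c : ℕ → ℕ) :
    antiForm a b c 0 = c 0 * (a - b) := by
  simp [antiForm, halfForm]; ring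

lemma antiForm_succ {R : Type*} [CommRing R] (a b : R) (c : ℕ → ℕ) (m : ℕ) :
    antiForm a b c (m + 1) =
      a * b * antiForm a b c m + c (m + 1) * (a ^ (2 * m + 3) - b ^ (2 * m + 3)) := by
  rw [antiForm, halfForm_succ, halfForm_succ, antiForm]; ring

lemma antiForm_add {R : Type*} [CommRing R] (a b : R) (c d : ℕ → ℕ) (m : ℕ) :
    antiForm a b (fun j => c j + d j) m = antiForm a b c m + antiForm a b d m := by
  induction m with
  | zero => simp [antiForm_zero]; ring
  | succ m ih => rw [antiForm_succ, antiForm_succ, antiForm_succ, ih]; push_cast; ring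

/-- The effect on coefficients of multiplication by `a² + a b + b²`. -/
def spread (c : ℕ → ℕ) : ℕ → ℕ
  | 0 => c 1
  | j + 1 => c j + c (j + 1) + c (j + 2)

lemma antiForm_spread {R : Type*} [CommRing R] (a b : R) (c : ℕ → ℕ) (m : ℕ) :
    antiForm a b (spread c) (m + 1) =
      (a ^ 2 + a * b + b ^ 2) * antiForm a b c m +
        c (m + 1) * (a * b * (a ^ (2 * m + 1) - b ^ (2 * m + 1)) +
          (a ^ (2 * m + 3) - b ^ (2 * m + 3))) +
        c (m + 2) * (a ^ (2 * m + 3) - b ^ (2 * m + 3)) := by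
  induction m with
  | zero => simp [antiForm_succ, antiForm_zero, spread]; ring
  | succ m ih =>
    rw [antiForm_succ, ih, antiForm_succ]
    simp only [spread]
    push_cast
    ring

/-- The coefficients of `(a - b) h_{2m}` and of `(a - b) (a + b) h_{2m+1} / (a b)`. -/
def pairCoeff : ℕ → (ℕ → ℕ) × (ℕ → ℕ)
  | 0 => (fun j => if j = 0 then 1 else 0, fun _ => 0)
  | 1 => (spread fun j => if j = 0 then 1 else 0,
      fun j => spread (fun j => if j = 0 then 1 else 0) j + if j = 0 then 1 else 0)
  | m + 2 => (fun j => spread (pairCoeff (m + 1)).1 j + (pairCoeff m).2 j,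
      fun j => spread (pairCoeff (m + 1)).2 j +
        (spread (pairCoeff (m + 1)).1 j + (pairCoeff (m + 1)).1 j))

lemma spread_eq_zero {c : ℕ → ℕ} {m : ℕ} (h : ∀ j, m < j → c j = 0) {j : ℕ} (hj : m + 1 < j) :
    spread c j = 0 := by
  obtain ⟨j, rfl⟩ := Nat.exists_eq_succ_of_ne_zero (by omega : j ≠ 0)
  simp [spread, h j (by omega), h (j + 1) (by omega), h (j + 2) (by omega)]

lemma pairCoeff_eq_zero (m : ℕ) :
    ∀ j, m < j → (pairCoeff m).1 j = 0 ∧ (pairCoeff m).2 j = 0 := by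
  have h0 : ∀ j, 0 < j → (if j = 0 then 1 else 0) = 0 := fun j hj => if_neg hj.ne'
  induction m using pairCoeff.induct with
  | case1 => intro j hj; simp [pairCoeff, hj.ne']
  | case2 =>
    intro j hj
    have := spread_eq_zero h0 hj
    simp only [pairCoeff, this, h0 j (by omega), and_self]
  | case3 m h1 h2 =>
    intro j hj
    have e1 := spread_eq_zero (fun j hj => (h1 j hj).1) hj
    have e2 := spread_eq_zero (fun j hj => (h1 j hj).2) hj
    simp only [pairCoeff]
    rw [e1, e2, (h1 j (by omega)).1, (h2 j (by omega)).2]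
    simp

lemma spread_pos {c : ℕ → ℕ} {m : ℕ} (hm : 1 ≤ m) (h : ∀ j ≤ m, 0 < c j) {j : ℕ}
    (hj : j ≤ m + 1) : 0 < spread c j := by
  cases j with
  | zero => exact h 1 hm
  | succ j => have := h j (by omega); simp only [spread]; omega

lemma pairCoeff_snd_pos (m : ℕ) : ∀ j ≤ m + 1, 0 < (pairCoeff (m + 1)).2 j := by
  induction m with
  | zero => intro j hj; interval_cases j <;> simp [pairCoeff, spread]
  | succ m ih =>
    intro j hj
    have := spread_pos (by omega) ih hj
    simp only [pairCoeff]
    omega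

lemma pairCoeff_fst_pos (m : ℕ) : ∀ j ≤ m + 2, 0 < (pairCoeff (m + 2)).1 j := by
  induction m with
  | zero => intro j hj; interval_cases j <;> simp [pairCoeff, spread]
  | succ m ih =>
    intro j hj
    have := spread_pos (by omega) ih hj
    exact Nat.add_pos_left this _

lemma antiForm_spread_of_eq_zero {R : Type*} [CommRing R] (a b : R) {c : ℕ → ℕ} {m : ℕ}
    (h : ∀ j, m < j → c j = 0) :
    antiForm a b (spread c) (m + 1) = (a ^ 2 + a * b + b ^ 2) * antiForm a b c m := by
  rw [antiForm_spread, h (m + 1) (by omega), h (m + 2) (by omega)]; simp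

lemma antiForm_succ_of_eq_zero {R : Type*} [CommRing R] (a b : R) {c : ℕ → ℕ} {m : ℕ}
    (h : c (m + 1) = 0) : antiForm a b c (m + 1) = a * b * antiForm a b c m := by
  rw [antiForm_succ, h]; simp

lemma antiForm_pairCoeff {R : Type*} [CommRing R] (a b : R) (m : ℕ) :
    antiForm a b (pairCoeff m).1 m = (a - b) * pairForm a b (2 * m) ∧
      a * b * antiForm a b (pairCoeff m).2 m =
        (a - b) * (a + b) * pairForm a b (2 * m + 1) := by
  induction m using pairCoeff.induct with
  | case1 => simp [antiForm_zero, pairCoeff, pairForm]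
  | case2 =>
    simp [antiForm_succ, antiForm_zero, pairCoeff, pairForm, spread]
    constructor <;> ring
  | case3 m h1 h2 =>
    have z1 := pairCoeff_eq_zero (m + 1)
    have z0 := pairCoeff_eq_zero m
    have e1 := antiForm_spread_of_eq_zero a b fun j hj => (z1 j hj).1
    have e2 := antiForm_spread_of_eq_zero a b fun j hj => (z1 j hj).2
    have e3 := antiForm_succ_of_eq_zero a b (z1 (m + 2) (by omega)).1
    have e4 := antiForm_succ_of_eq_zero a b (z0 (m + 1) (by omega)).2
    have e5 := antiForm_succ_of_eq_zero a b (z0 (m + 2) (by omega)).2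
    rw [show 2 * (m + 1) = 2 * m + 2 by ring, show 2 * m + 2 + 1 = 2 * m + 3 by ring] at h1
    rw [show 2 * (m + 2) = 2 * m + 1 + 3 by ring, show 2 * m + 1 + 3 + 1 = 2 * m + 2 + 3 by ring]
    rw [pairCoeff]
    simp only
    rw [antiForm_add, antiForm_add, antiForm_add, e1, e2, e3, e5, e4, pairForm, pairForm]
    constructor
    · linear_combination (a ^ 2 + a * b + b ^ 2) * h1.1 + a * b * h2.2
    · linear_combination (a ^ 2 + a * b + b ^ 2) * h1.2 + a * b * (a + b) ^ 2 * h1.1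

/-! ### A linear functional vanishing on the ideal -/

section Alternant

variable {σ : Type*} [Fintype σ] [DecidableEq σ]

/-- The signed sum of all permutations of the variables of a polynomial. -/
def alternant : MvPolynomial σ ℝ →ₗ[ℝ] MvPolynomial σ ℝ :=
  ∑ w : Equiv.Perm σ, ((Equiv.Perm.sign w : ℤ) : ℝ) • (rename w).toLinearMap

lemma alternant_apply (F : MvPolynomial σ ℝ) :
    alternant F = ∑ w : Equiv.Perm σ, ((Equiv.Perm.sign w : ℤ) : ℝ) • rename w F := by
  simp [alternant]

lemma alternant_rename (v : Equiv.Perm σ) (F : MvPolynomial σ ℝ) :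
    alternant (rename v F) = ((Equiv.Perm.sign v : ℤ) : ℝ) • alternant F := by
  rw [alternant_apply, alternant_apply, Finset.smul_sum]
  symm
  rw [← Equiv.sum_comp (Equiv.mulRight v)]
  refine Finset.sum_congr rfl fun w _ => ?_
  rw [rename_rename, smul_smul]
  rcases Int.units_eq_one_or (Equiv.Perm.sign v) with h | h <;> simp [h, ← Equiv.Perm.coe_mul]

lemma rename_alternant (v : Equiv.Perm σ) (F : MvPolynomial σ ℝ) :
    rename v (alternant F) = ((Equiv.Perm.sign v : ℤ) : ℝ) • alternant F := by
  rw [alternant_apply, map_sum, Finset.smul_sum, ← Equiv.sum_comp (Equiv.mulLeft v⁻¹)]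
  refine Finset.sum_congr rfl fun w _ => ?_
  rw [map_smul, rename_rename, smul_smul]
  rcases Int.units_eq_one_or (Equiv.Perm.sign v) with h | h <;> simp [h, ← Equiv.Perm.coe_mul]

lemma coeff_alternant_eq_zero {i j : σ} (hij : i ≠ j) {e : σ →₀ ℕ} (he : e i = e j)
    (F : MvPolynomial σ ℝ) : coeff e (alternant F) = 0 := by
  have h := coeff_rename_mapDomain (Equiv.swap i j) (Equiv.injective _) (alternant F) e
  have hm : Finsupp.mapDomain (Equiv.swap i j) e = e := by
    ext k
    rw [← Finsupp.equivMapDomain_eq_mapDomain, Finsupp.equivMapDomain_apply, Equiv.symm_swap]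
    rcases eq_or_ne k i with rfl | hi
    · rw [Equiv.swap_apply_left, he]
    rcases eq_or_ne k j with rfl | hj
    · rw [Equiv.swap_apply_right, he]
    rw [Equiv.swap_apply_of_ne_of_ne hi hj]
  rw [hm, rename_alternant, Equiv.Perm.sign_swap hij, coeff_smul] at h
  simp at h
  linarith

lemma coeff_alternant_esymm_mul {δ : σ →₀ ℕ} (hδ : ∀ i, 0 < δ i → ∃ j, δ j + 1 = δ i)
    {n : ℕ} (hn : 1 ≤ n) (F : MvPolynomial σ ℝ) :
    coeff δ (alternant (esymm σ ℝ n * F)) = 0 := by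
  have hmul : alternant (esymm σ ℝ n * F) = esymm σ ℝ n * alternant F := by
    rw [alternant_apply, alternant_apply, Finset.mul_sum]
    refine Finset.sum_congr rfl fun w _ => ?_
    rw [map_mul, esymm_isSymmetric σ ℝ n w, mul_smul_comm]
  rw [hmul, esymm_eq_sum_monomial, Finset.sum_mul, coeff_sum]
  refine Finset.sum_eq_zero fun t ht => ?_
  rw [coeff_monomial_mul']
  split_ifs with hle
  swap
  · rfl
  have hval : ∀ k, (∑ i ∈ t, Finsupp.single i 1 : σ →₀ ℕ) k = if k ∈ t then 1 else 0 := by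
    intro k
    simp [Finsupp.finsetSum_apply, Finsupp.single_apply]
  have hne : t.Nonempty := by
    rw [← Finset.card_pos, (Finset.mem_powersetCard.mp ht).2]; omega
  obtain ⟨i, hi, hmin⟩ := t.exists_min_image δ hne
  have hpos : 0 < δ i := by
    have := hle i
    rw [hval, if_pos hi] at this
    omega
  obtain ⟨j, hj⟩ := hδ i hpos
  have hjt : j ∉ t := fun h => by have := hmin j h; omega
  have hij : i ≠ j := fun h => hjt (h ▸ hi)
  rw [coeff_alternant_eq_zero hij, mul_zero]
  rw [Finsupp.tsub_apply, Finsupp.tsub_apply, hval, hval, if_pos hi, if_neg hjt]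
  omega

lemma coeff_alternant_eq_zero_of_mem {δ : σ →₀ ℕ} (hδ : ∀ i, 0 < δ i → ∃ j, δ j + 1 = δ i)
    {s : Set ℕ} (hs : ∀ n ∈ s, 1 ≤ n) {q : MvPolynomial σ ℝ}
    (hq : q ∈ Ideal.span ((fun n => esymm σ ℝ n) '' s)) :
    coeff δ (alternant q) = 0 := by
  suffices h : ∀ F, coeff δ (alternant (q * F)) = 0 by simpa using h 1
  induction hq using Submodule.span_induction with
  | mem x hx =>
    obtain ⟨n, hn, rfl⟩ := hx
    exact coeff_alternant_esymm_mul hδ (hs n hn)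
  | zero => simp
  | add x y _ _ hx hy => intro F; rw [add_mul, map_add, coeff_add, hx, hy, add_zero]
  | smul r x _ hx => intro F; rw [smul_eq_mul, mul_comm r x, mul_assoc]; exact hx _

lemma coeff_alternant_monomial {δ : σ →₀ ℕ} (hδ : Function.Injective δ) :
    coeff δ (alternant (monomial δ (1 : ℝ))) = 1 := by
  rw [alternant_apply, coeff_sum, Finset.sum_eq_single 1]
  · simp
  · intro w _ hw
    rw [rename_monomial, coeff_smul, coeff_monomial, if_neg, smul_zero]
    intro h
    refine hw (Equiv.ext fun k => hδ ?_)
    have := DFunLike.congr_fun h (w k)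
    rw [Finsupp.mapDomain_apply w.injective] at this
    simpa using this.symm
  · simp

/-! ### Products of forms in disjoint pairs of variables -/

variable {K : ℕ} {a b : Fin K → σ}

lemma alternant_prod_sub (hf : Function.Injective (Sum.elim a b))
    (G H : Fin K → MvPolynomial σ ℝ)
    (hGH : ∀ i, rename (Equiv.swap (a i) (b i)) (G i) = H i)
    (hG : ∀ i j, i ≠ j → rename (Equiv.swap (a i) (b i)) (G j) = G j)
    (hH : ∀ i j, i ≠ j → rename (Equiv.swap (a i) (b i)) (H j) = H j) :
    alternant (∏ i, (G i - H i)) = (2 : ℝ) ^ K • alternant (∏ i, G i) := by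
  suffices h : ∀ s : Finset (Fin K),
      alternant ((∏ i ∈ s, (G i - H i)) * ∏ i ∈ sᶜ, G i) =
        (2 : ℝ) ^ s.card • alternant (∏ i, G i) by
    simpa using h Finset.univ
  intro s
  induction s using Finset.induction_on with
  | empty => simp
  | insert i s hi ih =>
    have hic : i ∈ sᶜ := Finset.mem_compl.mpr hi
    rw [Finset.card_insert_of_notMem hi, pow_succ', mul_smul, ← ih, Finset.prod_insert hi,
      Finset.compl_insert, ← Finset.mul_prod_erase sᶜ G hic]
    set Q := (∏ j ∈ s, (G j - H j)) * ∏ j ∈ sᶜ.erase i, G j with hQ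
    have hQs : rename (Equiv.swap (a i) (b i)) Q = Q := by
      rw [hQ, map_mul, map_prod, map_prod]
      congr 1
      · refine Finset.prod_congr rfl fun j hj => ?_
        have hne : i ≠ j := fun h => hi (h ▸ hj)
        rw [map_sub, hG i j hne, hH i j hne]
      · exact Finset.prod_congr rfl fun j hj => hG i j (Finset.ne_of_mem_erase hj).symm
    have hab : a i ≠ b i := fun h => by simpa using @hf (.inl i) (.inr i) h
    have h := alternant_rename (Equiv.swap (a i) (b i)) (Q * G i)
    rw [map_mul, hQs, hGH, Equiv.Perm.sign_swap hab] at h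
    have e1 : (G i - H i) * (∏ j ∈ s, (G j - H j)) * ∏ j ∈ sᶜ.erase i, G j = Q * G i - Q * H i := by
      rw [hQ]; ring
    have e2 : (∏ j ∈ s, (G j - H j)) * (G i * ∏ j ∈ sᶜ.erase i, G j) = Q * G i := by
      rw [hQ]; ring
    rw [e1, e2, map_sub, h]
    simp [two_smul]

/-- Permuting the pairs of variables does not change the alternant. -/
lemma alternant_prod_comp_perm (hf : Function.Injective (Sum.elim a b)) (e f : Fin K → ℕ)
    (π : Equiv.Perm (Fin K)) :
    alternant (∏ i, (X (a i) ^ e (π i) * X (b i) ^ f (π i)) : MvPolynomial σ ℝ) =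
      alternant (∏ i, (X (a i) ^ e i * X (b i) ^ f i)) := by
  let w : Equiv.Perm σ := (Equiv.Perm.sumCongr π π).extendDomain (Equiv.ofInjective _ hf)
  have hw : Equiv.Perm.sign w = 1 := by
    rw [Equiv.Perm.sign_extendDomain, Equiv.Perm.sign_sumCongr, Int.units_mul_self]
  have ha : ∀ i, w (a i) = a (π i) := fun i =>
    Equiv.Perm.extendDomain_apply_image (Equiv.Perm.sumCongr π π) (Equiv.ofInjective _ hf) (.inl i)
  have hb : ∀ i, w (b i) = b (π i) := fun i =>
    Equiv.Perm.extendDomain_apply_image (Equiv.Perm.sumCongr π π) (Equiv.ofInjective _ hf) (.inr i)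
  have h := alternant_rename w (∏ i, (X (a i) ^ e (π i) * X (b i) ^ f (π i)))
  rw [hw] at h
  simp only [map_prod, map_mul, map_pow, rename_X, ha, hb, Units.val_one, Int.cast_one,
    one_smul] at h
  rw [← h, Equiv.prod_comp π fun i => (X (a i) ^ e i * X (b i) ^ f i : MvPolynomial σ ℝ)]

lemma alternant_prod_eq_zero (hf : Function.Injective (Sum.elim a b)) (e f : Fin K → ℕ)
    {κ : Fin K → Fin K} (hκ : ¬ Function.Injective κ) :
    alternant (∏ i, (X (a i) ^ e (κ i) * X (b i) ^ f (κ i)) : MvPolynomial σ ℝ) = 0 := by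
  obtain ⟨i, j, hκij, hij⟩ : ∃ i j, κ i = κ j ∧ i ≠ j := by
    simpa [Function.Injective] using hκ
  have ha : Function.Injective a := fun x y h => by simpa using @hf (.inl x) (.inl y) h
  have hne : ∀ x y, b x ≠ a y := fun x y h => by simpa using @hf (.inr x) (.inl y) h
  have h := alternant_rename (Equiv.swap (a i) (a j))
    (∏ i, (X (a i) ^ e (κ i) * X (b i) ^ f (κ i)))
  have hfix : rename (Equiv.swap (a i) (a j))
      (∏ i, (X (a i) ^ e (κ i) * X (b i) ^ f (κ i)) : MvPolynomial σ ℝ) =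
      ∏ i, (X (a i) ^ e (κ i) * X (b i) ^ f (κ i)) := by
    have hb : ∀ k, Equiv.swap (a i) (a j) (b k) = b k := fun k =>
      Equiv.swap_apply_of_ne_of_ne (hne _ _) (hne _ _)
    simp only [map_prod, map_mul, map_pow, rename_X, hb]
    rw [Finset.prod_mul_distrib, Finset.prod_mul_distrib]
    congr 1
    rw [← Equiv.prod_comp (Equiv.swap i j) fun k => (X (a k) ^ e (κ k) : MvPolynomial σ ℝ)]
    refine Finset.prod_congr rfl fun k _ => ?_
    rcases eq_or_ne k i with rfl | hi
    · simp [hκij]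
    rcases eq_or_ne k j with rfl | hj
    · simp [hκij]
    rw [Equiv.swap_apply_of_ne_of_ne hi hj,
      Equiv.swap_apply_of_ne_of_ne (ha.ne hi) (ha.ne hj)]
  rw [hfix, Equiv.Perm.sign_swap (ha.ne hij)] at h
  simpa [self_eq_neg] using h

lemma coeff_alternant_prod_sum_pos (hf : Function.Injective (Sum.elim a b)) (e f : Fin K → ℕ)
    {δ : σ →₀ ℕ} (hδ : Function.Injective δ)
    (hmon : ∏ i, (X (a i) ^ e i * X (b i) ^ f i) = monomial δ (1 : ℝ))
    {c : Fin K → ℝ} (hc : ∀ i, 0 < c i) :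
    0 < coeff δ (alternant (∏ i, ∑ k, c k • (X (a i) ^ e k * X (b i) ^ f k))) := by
  rw [Finset.prod_univ_sum, map_sum, coeff_sum]
  have hterm : ∀ κ : Fin K → Fin K,
      coeff δ (alternant (∏ i, c (κ i) • (X (a i) ^ e (κ i) * X (b i) ^ f (κ i)))) =
        if Function.Bijective κ then ∏ i, c (κ i) else 0 := by
    intro κ
    rw [Finset.prod_smul, map_smul, coeff_smul]
    split_ifs with h
    · have := alternant_prod_comp_perm hf e f (Equiv.ofBijective κ h)
      simp only [Equiv.ofBijective_apply] at this
      rw [this, hmon, coeff_alternant_monomial hδ, smul_eq_mul, mul_one]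
    · rw [alternant_prod_eq_zero hf e f fun hi => h (Finite.injective_iff_bijective.mp hi)]
      simp
  simp only [hterm]
  refine Finset.sum_pos' (fun κ _ => ?_) ⟨id, by simp, ?_⟩
  · split_ifs
    · exact Finset.prod_nonneg fun i _ => (hc _).le
    · exact le_rfl
  · rw [if_pos Function.bijective_id]
    exact Finset.prod_pos fun i _ => hc _

end Alternant

/-! ### The product modulo the ideal -/

lemma prod_X_add_C_mk_eq_pow {σ : Type*} [Fintype σ] {I : Ideal (MvPolynomial σ ℝ)}
    (hI : ∀ n ∈ Set.Icc 1 (Fintype.card σ), esymm σ ℝ n ∈ I) :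
    ∏ j : σ, (Polynomial.X + Polynomial.C (Ideal.Quotient.mk I (X j))) =
      Polynomial.X ^ Fintype.card σ := by
  have h := congrArg (Polynomial.map (Ideal.Quotient.mk I)) (prod_C_add_X_eq_sum_esymm ℝ σ)
  simp only [Polynomial.map_prod, Polynomial.map_sum, Polynomial.map_add, Polynomial.map_mul,
    Polynomial.map_pow, Polynomial.map_X, Polynomial.map_C] at h
  rw [h, Finset.sum_range_succ', Finset.sum_eq_zero, esymm_zero]
  · simp
  · intro n hn
    rw [Ideal.Quotient.eq_zero_iff_mem.mpr
      (hI (n + 1) ⟨by omega, by have := Finset.mem_range.mp hn; omega⟩)]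
    simp

lemma prod_prod_mem_iff {σ ι : Type*} [Fintype σ] [DecidableEq σ] [Fintype ι]
    {I : Ideal (MvPolynomial σ ℝ)} (hI : ∀ n ∈ Set.Icc 1 (Fintype.card σ), esymm σ ℝ n ∈ I)
    {n : ℕ} (hn : Fintype.card σ = n + 2) {a b : ι → σ} (hab : ∀ i, a i ≠ b i) :
    (∏ i, ∏ j ∈ Finset.univ \ {a i, b i}, (X (a i) + X (b i) + X j)) ∈ I ↔
      (∏ i, pairForm (X (a i)) (X (b i)) n) ∈ I := by
  have h := prod_X_add_C_mk_eq_pow hI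
  rw [hn] at h
  rw [← Ideal.Quotient.eq_zero_iff_mem, ← Ideal.Quotient.eq_zero_iff_mem, map_prod, map_prod]
  simp only [map_prod, map_add, map_pairForm]
  rw [Finset.prod_congr rfl fun i _ => prod_add_eq_pairForm _ n h (hab i)]

lemma exists_antiForm_eq (m r : ℕ) (hm : 2 ≤ m) (hr : r ≤ 1) :
    ∃ c : ℕ → ℕ, (∀ j ≤ m, 0 < c j) ∧ ∀ {R : Type} [CommRing R] (a b : R),
      (a * b) ^ r * antiForm a b c m = (a - b) * (a + b) ^ r * pairForm a b (2 * m + r) := by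
  obtain ⟨m, rfl⟩ := Nat.exists_eq_add_of_le' hm
  interval_cases r
  · exact ⟨_, pairCoeff_fst_pos m, fun a b => by simpa using (antiForm_pairCoeff a b (m + 2)).1⟩
  · exact ⟨_, pairCoeff_snd_pos (m + 1),
      fun a b => by simpa using (antiForm_pairCoeff a b (m + 2)).2⟩

lemma map_halfForm {R S : Type*} [CommRing R] [CommRing S] (f : R →+* S) (a b : R) (c : ℕ → ℕ)
    (m : ℕ) : f (halfForm a b c m) = halfForm (f a) (f b) c m := by
  simp [halfForm]

lemma prod_pairForm_notMem {σ : Type} [Fintype σ] [DecidableEq σ] {m r : ℕ} (hm : 2 ≤ m)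
    (hr : r ≤ 1) {a b : Fin (m + 1) → σ} (hf : Function.Injective (Sum.elim a b))
    {δ : σ →₀ ℕ} (hδ : Function.Injective δ) (hδ' : ∀ i, 0 < δ i → ∃ j, δ j + 1 = δ i)
    (hmon : ∏ i : Fin (m + 1), (X (a i) ^ (m + i + 1 + r) * X (b i) ^ (m - i + r)) =
      monomial δ (1 : ℝ)) {s : Set ℕ} (hs : ∀ n ∈ s, 1 ≤ n) :
    (∏ i, pairForm (X (a i)) (X (b i)) (2 * m + r)) ∉
      Ideal.span ((fun n => esymm σ ℝ n) '' s) := by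
  intro hmem
  obtain ⟨c, hc, hform⟩ := exists_antiForm_eq m r hm hr
  let G : Fin (m + 1) → MvPolynomial σ ℝ := fun i =>
    (X (a i) * X (b i)) ^ r * halfForm (X (a i)) (X (b i)) c m
  let H : Fin (m + 1) → MvPolynomial σ ℝ := fun i =>
    (X (a i) * X (b i)) ^ r * halfForm (X (b i)) (X (a i)) c m
  have hGH : ∏ i, (G i - H i) =
      (∏ i, ((X (a i) - X (b i)) * (X (a i) + X (b i)) ^ r)) *
        ∏ i, pairForm (X (a i)) (X (b i)) (2 * m + r) := by
    rw [← Finset.prod_mul_distrib]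
    refine Finset.prod_congr rfl fun i _ => ?_
    rw [← hform, ← mul_sub, antiForm]
  have hzero := coeff_alternant_eq_zero_of_mem hδ' hs (hGH ▸ Ideal.mul_mem_left _ _ hmem)
  have ha : ∀ i j, i ≠ j → a j ≠ a i := fun i j hij h =>
    hij (by simpa using (@hf (.inl j) (.inl i) h).symm)
  have hb : ∀ i j, i ≠ j → b j ≠ b i := fun i j hij h =>
    hij (by simpa using (@hf (.inr j) (.inr i) h).symm)
  have hne : ∀ i j, a i ≠ b j := fun i j h => by simpa using @hf (.inl i) (.inr j) h
  have hrename : ∀ (v : Equiv.Perm σ) (x y : σ),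
      rename v ((X x * X y) ^ r * halfForm (X x) (X y) c m : MvPolynomial σ ℝ) =
        (X (v x) * X (v y)) ^ r * halfForm (X (v x)) (X (v y)) c m := by
    intro v x y
    have := map_halfForm (rename v : MvPolynomial σ ℝ →ₐ[ℝ] _).toRingHom (X x) (X y) c m
    simp only [AlgHom.toRingHom_eq_coe, RingHom.coe_coe, rename_X] at this
    simp [this]
  have hHc : ∀ i, H i = (X (b i) * X (a i)) ^ r * halfForm (X (b i)) (X (a i)) c m := fun i => by
    rw [mul_comm (X (b i))]
  rw [alternant_prod_sub hf G H, coeff_smul] at hzero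
  · have hpos := coeff_alternant_prod_sum_pos hf (fun i => m + i + 1 + r) (fun i => m - i + r) hδ
      hmon (c := fun i => (c i : ℝ)) fun i => by exact_mod_cast hc i (by omega)
    have hGs : ∀ i, G i = ∑ k : Fin (m + 1),
        (c k : ℝ) • (X (a i) ^ (m + k + 1 + r) * X (b i) ^ (m - k + r)) := by
      intro i
      simp only [G]
      rw [halfForm, Finset.sum_range, Finset.mul_sum]
      refine Finset.sum_congr rfl fun k _ => ?_
      have hk : m + (k : ℕ) + 1 + r = r + (m - k) + (2 * k + 1) := by omega
      rw [hk, smul_eq_C_mul, map_natCast]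
      ring
    simp only [← hGs] at hpos
    have : (0 : ℝ) < 2 ^ (m + 1) := by positivity
    simp only [smul_eq_mul] at hzero
    exact (mul_pos this hpos).ne' hzero
  · intro i
    rw [hHc, hrename, Equiv.swap_apply_left, Equiv.swap_apply_right]
  · intro i j hij
    rw [hrename, Equiv.swap_apply_of_ne_of_ne (ha i j hij) (hne j i),
      Equiv.swap_apply_of_ne_of_ne (hne i j).symm (hb i j hij)]
  · intro i j hij
    rw [hHc, hrename, Equiv.swap_apply_of_ne_of_ne (ha i j hij) (hne j i),
      Equiv.swap_apply_of_ne_of_ne (hne i j).symm (hb i j hij)]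

/-! ### The variables `x_{2i-1}`, `x_{2i}` -/

/-- The exponent vector of the monomial used to detect `q₀`. -/
def pairExponent (m r : ℕ) : Fin (2 * (m + 1) + r) →₀ ℕ :=
  Finsupp.equivFunOnFinite.symm fun x =>
    if (x : ℕ) < 2 * (m + 1) then
      if (x : ℕ) % 2 = 0 then m + x / 2 + 1 + r else m - x / 2 + r
    else 0

lemma pairExponent_apply (m r : ℕ) (x : Fin (2 * (m + 1) + r)) :
    pairExponent m r x =
      if (x : ℕ) < 2 * (m + 1) then
        if (x : ℕ) % 2 = 0 then m + x / 2 + 1 + r else m - x / 2 + r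
      else 0 := rfl

lemma pairExponent_injective {m r : ℕ} (hr : r ≤ 1) : Function.Injective (pairExponent m r) := by
  intro x y h
  rw [pairExponent_apply, pairExponent_apply] at h
  have hx := x.2
  have hy := y.2
  apply Fin.ext
  split_ifs at h <;> omega

lemma exists_pairExponent_succ {m r : ℕ} (hr : r ≤ 1) (x : Fin (2 * (m + 1) + r))
    (hx : 0 < pairExponent m r x) : ∃ y, pairExponent m r y + 1 = pairExponent m r x := by
  have hlt : pairExponent m r x < 2 * (m + 1) + r := by
    have := x.2
    rw [pairExponent_apply]
    split_ifs <;> omega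
  generalize pairExponent m r x = v at hx hlt
  rcases lt_or_ge (m + 1 + r) v with h | h
  · refine ⟨⟨2 * (v - 1 - (m + 1 + r)), by omega⟩, ?_⟩
    rw [pairExponent_apply, if_pos (by simp only; omega), if_pos (by simp only; omega)]
    simp only
    omega
  rcases lt_or_ge r v with h' | h'
  · refine ⟨⟨2 * (m + r - (v - 1)) + 1, by omega⟩, ?_⟩
    rw [pairExponent_apply, if_pos (by simp only; omega), if_neg (by simp only; omega)]
    simp only
    omega
  · refine ⟨⟨2 * (m + 1), by omega⟩, ?_⟩
    rw [pairExponent_apply, if_neg (by simp)]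
    omega

lemma prod_range_two_mul {M : Type*} [CommMonoid M] (g : ℕ → M) (k : ℕ) :
    ∏ x ∈ Finset.range (2 * k), g x =
      ∏ i ∈ Finset.range k, (g (2 * i) * g (2 * i + 1)) := by
  induction k with
  | zero => simp
  | succ k ih =>
    rw [Finset.prod_range_succ, ← ih, Nat.mul_succ, Finset.prod_range_succ,
      Finset.prod_range_succ, mul_assoc]

lemma prod_X_pow_eq_monomial_pairExponent (m r : ℕ) :
    ∏ i : Fin (m + 1), ((X ⟨2 * i, by omega⟩ : MvPolynomial (Fin (2 * (m + 1) + r)) ℝ) ^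
        (m + i + 1 + r) * X ⟨2 * i + 1, by omega⟩ ^ (m - i + r)) =
      monomial (pairExponent m r) (1 : ℝ) := by
  rw [monomial_eq, C_1, one_mul, Finsupp.prod_fintype _ _ fun _ => pow_zero _]
  let g : ℕ → MvPolynomial (Fin (2 * (m + 1) + r)) ℝ := fun x =>
    if h : x < 2 * (m + 1) + r then X ⟨x, h⟩ ^ pairExponent m r ⟨x, h⟩ else 1
  have h1 : ∏ x, X x ^ pairExponent m r x = ∏ x : Fin (2 * (m + 1) + r), g x :=
    Finset.prod_congr rfl fun x _ => by simp [g]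
  have h2 : ∏ x ∈ Finset.range r, g (2 * (m + 1) + x) = 1 :=
    Finset.prod_eq_one fun x _ => by simp [g, pairExponent_apply]
  rw [h1, ← Finset.prod_range, Finset.prod_range_add, h2, mul_one, prod_range_two_mul,
    Finset.prod_range]
  refine Finset.prod_congr rfl fun i _ => ?_
  have hi := i.2
  have e1 : (2 * (i : ℕ) + 1) / 2 = i := by omega
  simp only [g]
  rw [dif_pos (by omega), dif_pos (by omega), pairExponent_apply, pairExponent_apply,
    if_pos (by simp only; omega), if_pos (by simp only; omega), if_pos (by simp only; omega),
    if_neg (by simp only; omega)]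
  simp only [e1, Nat.mul_div_cancel_left _ two_pos]

lemma xv_succ {M : ℕ} (x : Fin M) : xv M (x + 1) = X x := by
  rw [xv, dif_pos ⟨by omega, by omega⟩]
  rfl

lemma prod_Icc_one_sdiff_pair {N : Type*} [CommMonoid N] {M : ℕ} (g : ℕ → N) (a b : Fin M) :
    ∏ j ∈ Finset.Icc 1 M \ {(a : ℕ) + 1, (b : ℕ) + 1}, g j =
      ∏ j ∈ Finset.univ \ {a, b}, g ((j : ℕ) + 1) := by
  symm
  refine Finset.prod_bij (fun j _ => (j : ℕ) + 1) (fun j hj => ?_) (fun i _ j _ h => ?_)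
    (fun k hk => ?_) fun _ _ => rfl
  · simp [Fin.ext_iff] at hj ⊢
    omega
  · exact Fin.ext (by simpa using h)
  · simp only [Finset.mem_sdiff, Finset.mem_Icc, Finset.mem_insert, Finset.mem_singleton] at hk
    refine ⟨⟨k - 1, by omega⟩, ?_, by simp only; omega⟩
    simp [Fin.ext_iff]
    omega

lemma prod_Icc_eq_prod_fin (m r : ℕ) :
    (∏ i ∈ Finset.Icc 1 (m + 1),
      ∏ j ∈ Finset.Icc 1 (2 * (m + 1) + r) \ {2 * i - 1, 2 * i},
        (xv (2 * (m + 1) + r) (2 * i - 1) + xv (2 * (m + 1) + r) (2 * i) +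
          xv (2 * (m + 1) + r) j)) =
      ∏ i : Fin (m + 1), ∏ j ∈ Finset.univ \
          {(⟨2 * i, by omega⟩ : Fin (2 * (m + 1) + r)), ⟨2 * i + 1, by omega⟩},
        (X ⟨2 * i, by omega⟩ + X ⟨2 * i + 1, by omega⟩ + X j) := by
  rw [← Finset.Ico_add_one_right_eq_Icc, Finset.prod_Ico_eq_prod_range, Finset.prod_range]
  refine Finset.prod_congr rfl fun i _ => ?_
  have h := prod_Icc_one_sdiff_pair (M := 2 * (m + 1) + r)
    (fun j => xv (2 * (m + 1) + r) (2 * i + 1) + xv (2 * (m + 1) + r) (2 * i + 1 + 1) +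
      xv (2 * (m + 1) + r) j)
    ⟨2 * i, by omega⟩ ⟨2 * i + 1, by omega⟩
  have e1 : 2 * (1 + (i : ℕ)) - 1 = 2 * i + 1 := by omega
  have e2 : 2 * (1 + (i : ℕ)) = 2 * i + 1 + 1 := by omega
  rw [e1, e2, h]
  refine Finset.prod_congr rfl fun j _ => ?_
  rw [xv_succ j, ← xv_succ ⟨2 * i, by omega⟩, ← xv_succ ⟨2 * i + 1, by omega⟩]

/-- For `M ≥ 6` and `K = ⌊M/2⌋`, the polynomial
`q₀ = Π_{i=1}^{K} Π_{j ∈ {1,…,M} \ {2i-1, 2i}} (x_{2i-1} + x_{2i} + x_j)`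
does not lie in the ideal generated by the elementary symmetric polynomials
`σ_1, …, σ_M` of `x_1, …, x_M`. -/
theorem q0_not_in_symmetric_ideal (M : ℕ) (hM : 6 ≤ M) (K : ℕ) (hK : K = M / 2) :
    (∏ i ∈ Finset.Icc 1 K, ∏ j ∈ Finset.Icc 1 M \ {2 * i - 1, 2 * i},
        (xv M (2 * i - 1) + xv M (2 * i) + xv M j))
      ∉ Ideal.span ((fun n => MvPolynomial.esymm (Fin M) ℝ n) '' Set.Icc 1 M) := by
  obtain ⟨m, r, hm, hr, rfl, rfl⟩ :
      ∃ m r, 2 ≤ m ∧ r ≤ 1 ∧ M = 2 * (m + 1) + r ∧ K = m + 1 :=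
    ⟨K - 1, M % 2, by omega, by omega, by omega, by omega⟩
  have hinj : Function.Injective (Sum.elim
      (fun i : Fin (m + 1) => (⟨2 * i, by omega⟩ : Fin (2 * (m + 1) + r)))
      (fun i : Fin (m + 1) => ⟨2 * i + 1, by omega⟩)) := by
    rintro (i | i) (j | j) h <;> simp [Fin.ext_iff] at h ⊢ <;> omega
  rw [prod_Icc_eq_prod_fin, prod_prod_mem_iff (n := 2 * m + r)]
  · exact prod_pairForm_notMem hm hr hinj (pairExponent_injective hr)
      (exists_pairExponent_succ hr) (prod_X_pow_eq_monomial_pairExponent m r) fun n hn => hn.1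
  · intro n hn
    rw [Fintype.card_fin] at hn
    exact Ideal.subset_span ⟨n, hn, rfl⟩
  · rw [Fintype.card_fin]; omega
  · intro i
    simp [Fin.ext_iff]
end
end
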